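/- The set of pairs (f_0, f_1) realized by 5-polytopes of excess degree strictly larger than 5 is exactly {(f0, f1) : (5/2)·f0 + 5/2 < f1 ≤ f0·(f0−1)/2}. -/

import Mathlib

open Set

/-- A polytope: the convex hull of a finite set of points. -/
def IsPolytope {n : ℕ} (P : Set (Fin n → ℝ)) : Prop :=
  ∃ S : Finset (Fin n → ℝ), P = convexHull ℝ (S : Set (Fin n → ℝ))

/-- The affine dimension of a set: the rank of its vector span. -/
noncomputable def adim {n : ℕ} (P : Set (Fin n → ℝ)) : ℕ :=
  Module.finrank ℝ (vectorSpan ℝ P)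

/-- A `d`-polytope: a polytope whose affine hull has dimension `d`. -/
def IsDPolytope (d : ℕ) {n : ℕ} (P : Set (Fin n → ℝ)) : Prop :=
  IsPolytope P ∧ adim P = d

/-- An edge of `P`: a face (an extreme convex subset) of affine dimension 1. -/
def IsEdge {n : ℕ} (P E : Set (Fin n → ℝ)) : Prop :=
  IsExtreme ℝ P E ∧ Convex ℝ E ∧ adim E = 1

/-- `f₀ P`: the number of vertices (extreme points) of `P`. -/
noncomputable def f₀ {n : ℕ} (P : Set (Fin n → ℝ)) : ℕ :=
  (Set.extremePoints ℝ P).ncard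

/-- `f₁ P`: the number of edges of `P`. -/
noncomputable def f₁ {n : ℕ} (P : Set (Fin n → ℝ)) : ℕ :=
  {E : Set (Fin n → ℝ) | IsEdge P E}.ncard

/-- `E^d`: the set of `(f₀, f₁)` pairs realized by `d`-polytopes. -/
def fPairs (d : ℕ) : Set (ℕ × ℕ) :=
  {p | ∃ (n : ℕ) (P : Set (Fin n → ℝ)), IsDPolytope d P ∧ f₀ P = p.1 ∧ f₁ P = p.2}

open Filter Topology

/-! ### Point configurations up to positive scaling -/

namespace ConeConfig

/-- The index set `A` spans a face of the cone generated by `p`: some linear functional vanishes on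
`A` and is positive on all other generators. -/
def Exposes {E ι : Type*} [AddCommGroup E] [Module ℝ E] (p : ι → E) (A : Set ι) : Prop :=
  ∃ φ : E →ₗ[ℝ] ℝ, (∀ i ∈ A, φ (p i) = 0) ∧ ∀ i ∉ A, 0 < φ (p i)

/-- Two generators span a two-dimensional face of the cone. -/
def Adj {E ι : Type*} [AddCommGroup E] [Module ℝ E] (p : ι → E) (i j : ι) : Prop :=
  i ≠ j ∧ Exposes p {i, j}

open Classical in
/-- The sum of the vertex degrees of the graph `Adj p`. -/
noncomputable def degSum {E ι : Type*} [AddCommGroup E] [Module ℝ E] [Fintype ι] (p : ι → E) : ℕ :=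
  ∑ i, ∑ j, if Adj p i j then 1 else 0

/-- The cone generated by `p` is pointed and full-dimensional, and its extreme rays are exactly
the rays through the `p i`. -/
structure IsPointed {E ι : Type*} [AddCommGroup E] [Module ℝ E] (p : ι → E) : Prop where
  empty : Exposes p ∅
  singleton : ∀ i, Exposes p {i}
  span : Submodule.span ℝ (range p) = ⊤

/-- `(u₀, u)` is a basis of `E` with dual basis `(α, β)`. -/
structure IsDualFrame {E κ : Type*} [AddCommGroup E] [Module ℝ E] [Fintype κ]
    (u₀ : E) (u : κ → E) (α : E →ₗ[ℝ] ℝ) (β : κ → E →ₗ[ℝ] ℝ) : Prop where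
  apex : α u₀ = 1
  apex_base : ∀ k, α (u k) = 0
  base_apex : ∀ k, β k u₀ = 0
  base_self : ∀ k, β k (u k) = 1
  base_ne : ∀ k l, k ≠ l → β k (u l) = 0
  expand : ∀ x, x = α x • u₀ + ∑ k, β k x • u k

/-- The vertex `v` is simple, with neighbours `w k`. -/
def IsSimpleVertex {E ι κ : Type*} [AddCommGroup E] [Module ℝ E] [Fintype κ]
    (p : ι → E) (v : ι) (w : κ → ι) : Prop :=
  ∃ α β, IsDualFrame (p v) (p ∘ w) α β ∧ (∀ k i, 0 ≤ β k (p i)) ∧ ∀ k, Adj p v (w k)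

/-- The `F k` are the vertices of a simplex facet, and `o` is a vertex outside it. -/
def IsSimplexFacet {E ι κ : Type*} [AddCommGroup E] [Module ℝ E] [Fintype κ]
    (p : ι → E) (o : ι) (F : κ → ι) : Prop :=
  ∃ α β, IsDualFrame (p o) (p ∘ F) α β ∧ ∀ i ∉ range F, 0 < α (p i)

section Basic

variable {E ι κ : Type*} [AddCommGroup E] [Module ℝ E]

theorem Adj.symm {p : ι → E} {i j : ι} (h : Adj p i j) : Adj p j i :=
  ⟨h.1.symm, by rw [Set.pair_comm]; exact h.2⟩

theorem adj_comm {p : ι → E} {i j : ι} : Adj p i j ↔ Adj p j i :=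
  ⟨Adj.symm, Adj.symm⟩

theorem not_adj_self (p : ι → E) (i : ι) : ¬ Adj p i i := fun h => h.1 rfl

theorem IsDualFrame.of_finrank [Fintype κ] {u₀ : E} {u : κ → E} {α : E →ₗ[ℝ] ℝ}
    {β : κ → E →ₗ[ℝ] ℝ} (hE : Module.finrank ℝ E = Fintype.card κ + 1)
    (h1 : α u₀ = 1) (h2 : ∀ k, α (u k) = 0) (h3 : ∀ k, β k u₀ = 0) (h4 : ∀ k, β k (u k) = 1)
    (h5 : ∀ k l, k ≠ l → β k (u l) = 0) : IsDualFrame u₀ u α β := by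
  classical
  refine ⟨h1, h2, h3, h4, h5, ?_⟩
  have : FiniteDimensional ℝ E := FiniteDimensional.of_finrank_pos (by omega)
  let b : Option κ → E := fun o => o.elim u₀ u
  have key : ∀ (g : Option κ → ℝ), ∀ l, β l (∑ i, g i • b i) = g (some l) := by
    intro g l
    simp only [b, Fintype.sum_option, Option.elim, map_add, map_sum, map_smul, h3, smul_eq_mul,
      mul_zero, zero_add]
    rw [Finset.sum_eq_single l]
    · simp [h4]
    · intro k _ hk; simp [h5 l k hk.symm]
    · simp
  have key0 : ∀ (g : Option κ → ℝ), α (∑ i, g i • b i) = g none := by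
    intro g
    simp [b, Fintype.sum_option, h1, h2]
  have hli : LinearIndependent ℝ b := by
    rw [Fintype.linearIndependent_iff]
    intro g hg i
    cases i with
    | none => rw [← key0 g, hg, map_zero]
    | some l => rw [← key g l, hg, map_zero]
  let B := basisOfLinearIndependentOfCardEqFinrank hli (by simp [hE])
  intro x
  have hx := (B.sum_repr x).symm
  simp only [B, coe_basisOfLinearIndependentOfCardEqFinrank] at hx
  have h0 : α x = B.repr x none := by conv_lhs => rw [hx, key0]
  have hl : ∀ l, β l x = B.repr x (some l) := fun l => by conv_lhs => rw [hx, key]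
  conv_lhs => rw [hx]
  simp only [h0, hl, Fintype.sum_option, b, Option.elim]
  rfl

open Classical in
theorem degSum_option {E' : Type*} [AddCommGroup E'] [Module ℝ E'] [Fintype ι] {p : ι → E}
    {q : Option ι → E'} (F : Finset ι) (hs : ∀ i j, Adj q (some i) (some j) ↔ Adj p i j)
    (hn : ∀ i, Adj q none (some i) ↔ i ∈ F) : degSum q = degSum p + 2 * F.card := by
  have hn' : ∀ i, Adj q (some i) none ↔ i ∈ F := fun i => adj_comm.trans (hn i)
  simp only [degSum, Fintype.sum_option, hs, hn, hn', not_adj_self, if_false,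
    Finset.sum_add_distrib]
  simp
  ring

end Basic

section Pyramid

/-- The pyramid over a configuration. -/
def pyramid {E ι : Type*} [AddCommGroup E] (p : ι → E) : Option ι → E × ℝ
  | none => (0, 1)
  | some i => (p i, 0)

@[simp] theorem pyramid_none {E ι : Type*} [AddCommGroup E] (p : ι → E) :
    pyramid p none = (0, 1) := rfl

@[simp] theorem pyramid_some {E ι : Type*} [AddCommGroup E] (p : ι → E) (i : ι) :
    pyramid p (some i) = (p i, 0) := rfl

variable {E ι κ : Type*} [AddCommGroup E] [Module ℝ E]

theorem exposes_pyramid_some {p : ι → E} {A : Set ι} {B : Set (Option ι)}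
    (hB : ∀ i, some i ∈ B ↔ i ∈ A) : Exposes (pyramid p) B ↔ Exposes p A := by
  classical
  constructor
  · rintro ⟨φ, h0, h1⟩
    refine ⟨φ ∘ₗ LinearMap.inl ℝ E ℝ, fun i hi => ?_, fun i hi => ?_⟩
    · simpa using h0 (some i) ((hB i).2 hi)
    · simpa using h1 (some i) (fun h => hi ((hB i).1 h))
  · rintro ⟨φ, h0, h1⟩
    refine ⟨φ ∘ₗ LinearMap.fst ℝ E ℝ + (if none ∈ B then 0 else 1 : ℝ) • LinearMap.snd ℝ E ℝ,
      fun i hi => ?_, fun i hi => ?_⟩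
    · cases i with
      | none => simp [hi]
      | some i =>
        have := h0 i ((hB i).1 hi)
        split_ifs <;> simpa using this
    · cases i with
      | none => simp [hi]
      | some i =>
        have := h1 i (fun h => hi ((hB i).2 h))
        split_ifs <;> simpa using this

theorem adj_pyramid_some {p : ι → E} (i j : ι) :
    Adj (pyramid p) (some i) (some j) ↔ Adj p i j := by
  unfold Adj
  rw [exposes_pyramid_some (A := {i, j}) (by simp)]
  simp

theorem adj_pyramid_none {p : ι → E} (hp : IsPointed p) (i : ι) :
    Adj (pyramid p) none (some i) :=
  ⟨by simp, (exposes_pyramid_some (A := {i}) (by simp)).2 (hp.singleton i)⟩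

theorem IsPointed.pyramid {p : ι → E} (hp : IsPointed p) : IsPointed (pyramid p) where
  empty := (exposes_pyramid_some (A := ∅) (by simp)).2 hp.empty
  singleton
    | none => (exposes_pyramid_some (A := ∅) (by simp)).2 hp.empty
    | some i => (exposes_pyramid_some (A := {i}) (by simp)).2 (hp.singleton i)
  span := by
    rw [eq_top_iff]
    rintro ⟨x, t⟩ -
    have hx : x ∈ Submodule.span ℝ (range p) := hp.span ▸ Submodule.mem_top
    have h1 : (x, (0 : ℝ)) ∈ Submodule.span ℝ (range (ConeConfig.pyramid p)) := by
      have : (x, (0 : ℝ)) ∈ (Submodule.span ℝ (range p)).map (LinearMap.inl ℝ E ℝ) :=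
        ⟨x, hx, by simp⟩
      rw [Submodule.map_span] at this
      refine Submodule.span_mono ?_ this
      rintro _ ⟨_, ⟨i, rfl⟩, rfl⟩
      exact ⟨some i, by simp⟩
    have h2 : ((0 : E), t) ∈ Submodule.span ℝ (range (ConeConfig.pyramid p)) := by
      have := Submodule.smul_mem (Submodule.span ℝ (range (ConeConfig.pyramid p))) t
        (Submodule.subset_span ⟨none, rfl⟩)
      simpa using this
    simpa using Submodule.add_mem _ h1 h2

theorem degSum_pyramid [Fintype ι] {p : ι → E} (hp : IsPointed p) :
    degSum (pyramid p) = degSum p + 2 * Fintype.card ι :=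
  degSum_option Finset.univ adj_pyramid_some fun i => by simpa using adj_pyramid_none hp i

theorem IsDualFrame.pyramid [Fintype κ] {p : ι → E} {v : ι} {w : κ → ι} {α : E →ₗ[ℝ] ℝ}
    {β : κ → E →ₗ[ℝ] ℝ} (h : IsDualFrame (p v) (p ∘ w) α β) :
    IsDualFrame (pyramid p (some v)) (pyramid p ∘ Option.map w) (α ∘ₗ LinearMap.fst ℝ E ℝ)
      (fun k => k.elim (LinearMap.snd ℝ E ℝ) fun k => β k ∘ₗ LinearMap.fst ℝ E ℝ) where
  apex := by simpa using h.apex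
  apex_base k := by cases k <;> simp; exact h.apex_base _
  base_apex k := by cases k <;> simp; exact h.base_apex _
  base_self k := by cases k <;> simp; exact h.base_self _
  base_ne k l hkl := by
    cases k <;> cases l <;> simp at hkl ⊢
    exact h.base_ne _ _ hkl
  expand := by
    rintro ⟨x, t⟩
    simp only [Fintype.sum_option, Option.elim, Function.comp, Option.map, pyramid_none,
      pyramid_some, LinearMap.coe_comp, LinearMap.fst_apply, LinearMap.snd_apply]
    ext
    · simpa [Prod.fst_sum] using h.expand x
    · simp [Prod.snd_sum]

theorem IsSimpleVertex.pyramid [Fintype κ] {p : ι → E} (hp : IsPointed p) {v : ι} {w : κ → ι}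
    (h : IsSimpleVertex p v w) :
    IsSimpleVertex (pyramid p) (some v) (Option.map w) := by
  obtain ⟨α, β, hf, hn, ha⟩ := h
  refine ⟨_, _, hf.pyramid, fun k i => ?_, fun k => ?_⟩
  · cases k <;> cases i <;> simp [hn]
  · cases k with
    | none => exact (adj_pyramid_none hp v).symm
    | some k => exact (adj_pyramid_some _ _).2 (ha k)

theorem IsSimplexFacet.pyramid [Fintype κ] {p : ι → E} {o : ι} {F : κ → ι}
    (h : IsSimplexFacet p o F) : IsSimplexFacet (pyramid p) (some o) (Option.map F) := by
  obtain ⟨α, β, hf, hn⟩ := h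
  refine ⟨_, _, hf.pyramid, fun i hi => ?_⟩
  cases i with
  | none => exact absurd ⟨none, rfl⟩ hi
  | some i =>
    refine hn i fun ⟨k, hk⟩ => hi ⟨some k, by simp [hk]⟩

end Pyramid
section Truncation

variable {E ι κ : Type*} [AddCommGroup E] [Module ℝ E]

/-- Replace the vertex `v` by new vertices close to `v` on the edges joining `v` to the `w k`. -/
def truncation (p : ι → E) (v : ι) (w : κ → ι) (s : ℝ) : {i // i ≠ v} ⊕ κ → E
  | .inl i => p i
  | .inr k => p v + s • p (w k)

@[simp] theorem truncation_inl (p : ι → E) (v : ι) (w : κ → ι) (s : ℝ) (i : {i // i ≠ v}) :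
    truncation p v w s (.inl i) = p i := rfl

@[simp] theorem truncation_inr (p : ι → E) (v : ι) (w : κ → ι) (s : ℝ) (k : κ) :
    truncation p v w s (.inr k) = p v + s • p (w k) := rfl

open Classical in
theorem exists_truncation [Fintype ι] [Fintype κ] {p : ι → E} (hp : IsPointed p) {v : ι}
    {w : κ → ι} (hv : IsSimpleVertex p v w) (hE : Module.finrank ℝ E = Fintype.card κ + 1)
    (k₀ : κ) : ∃ q : {i // i ≠ v} ⊕ κ → E, IsPointed q ∧
      degSum q = degSum p + Fintype.card κ * (Fintype.card κ - 1) ∧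
      (∃ v' w', IsSimpleVertex (κ := κ) q v' w') ∧ ∃ o F, IsSimplexFacet (κ := κ) q o F := by
  obtain ⟨α, β, hf, hβ, hadj⟩ := hv
  have hwv : ∀ k, w k ≠ v := fun k => (hadj k).1.symm
  have hexp : ∀ i, p i = α (p i) • p v + ∑ k, β k (p i) • p (w k) := fun i => hf.expand (p i)
  have hαw : ∀ k, α (p (w k)) = 0 := hf.apex_base
  have hβw : ∀ k l, k ≠ l → β k (p (w l)) = 0 := hf.base_ne
  have hβs : ∀ k, β k (p (w k)) = 1 := hf.base_self
  set σ : E →ₗ[ℝ] ℝ := ∑ k, β k with hσ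
  have hσv : σ (p v) = 0 := by simp [hσ, hf.base_apex]
  have hσw : ∀ k, σ (p (w k)) = 1 := by
    intro k
    rw [hσ, LinearMap.sum_apply, Finset.sum_eq_single k (fun l _ hl => hβw l k hl) (by simp)]
    exact hβs k
  have hpos : ∀ i ≠ v, 0 < σ (p i) := by
    intro i hi
    have h0 : 0 ≤ σ (p i) := by
      rw [hσ, LinearMap.sum_apply]; exact Finset.sum_nonneg fun k _ => hβ k i
    refine h0.lt_of_ne fun h => ?_
    have hz : ∀ k, β k (p i) = 0 := by
      rw [hσ, LinearMap.sum_apply, eq_comm, Finset.sum_eq_zero_iff_of_nonneg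
        (fun k _ => hβ k i)] at h
      exact fun k => h k (Finset.mem_univ k)
    obtain ⟨φ, h0, h1⟩ := hp.singleton v
    have := h1 i hi
    rw [hexp i] at this
    simp [hz, h0 v rfl] at this
  obtain ⟨s, hs, hη⟩ : ∃ s : ℝ, 0 < s ∧ ∀ i ≠ v, 0 < (σ - s • α) (p i) := by
    have : ∀ᶠ s : ℝ in 𝓝[>] 0, ∀ i, i ≠ v → 0 < (σ - s • α) (p i) := by
      rw [Filter.eventually_all]
      intro i
      by_cases hi : i = v
      · simp [hi]
      have hc : Tendsto (fun s : ℝ => (σ - s • α) (p i)) (𝓝[>] 0)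
          (𝓝 ((σ - (0 : ℝ) • α) (p i))) := by
        refine (Continuous.tendsto ?_ 0).mono_left nhdsWithin_le_nhds
        simp only [LinearMap.sub_apply, LinearMap.smul_apply, smul_eq_mul]
        fun_prop
      simp only [zero_smul, sub_zero] at hc
      exact (hc.eventually_const_lt (hpos i hi)).mono fun s hs _ => hs
    obtain ⟨s, h1, h2⟩ := (this.and self_mem_nhdsWithin).exists
    exact ⟨s, h2, h1⟩
  set η : E →ₗ[ℝ] ℝ := σ - s • α with hηdef
  set q := truncation p v w s with hq
  have hql : ∀ i, q (.inl i) = p i := fun _ => rfl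
  have hqr : ∀ k, q (.inr k) = p v + s • p (w k) := fun _ => rfl
  have hηv : η (p v) = -s := by simp [hηdef, hσv, hf.apex]
  have hηw : ∀ k, η (p (w k)) = 1 := by intro k; simp [hηdef, hσw, hαw]
  have hηq : ∀ k, η (q (.inr k)) = 0 := by intro k; simp [hq, hηv, hηw]
  have hβq : ∀ k, β k (q (.inr k)) = s := by
    intro k
    have := hf.base_apex k
    simp [hq, hβs, this]
  have hβq' : ∀ k l, k ≠ l → β k (q (.inr l)) = 0 := by
    intro k l hkl
    have := hf.base_apex k
    simp [hq, hβw k l hkl, this]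
  -- the key relation expressing old generators through the truncated ones
  have hrel : ∀ (φ : E →ₗ[ℝ] ℝ) i,
      s * φ (p i) = - η (p i) * φ (p v) + ∑ k, β k (p i) * φ (q (.inr k)) := by
    intro φ i
    have h1 : φ (p i) = α (p i) * φ (p v) + ∑ k, β k (p i) * φ (p (w k)) := by
      conv_lhs => rw [hexp i]
      simp
    have h2 : ∑ k, β k (p i) * φ (q (.inr k)) =
        σ (p i) * φ (p v) + s * ∑ k, β k (p i) * φ (p (w k)) := by
      simp only [hq, truncation_inr, map_add, map_smul, smul_eq_mul, mul_add,
        Finset.sum_add_distrib, hσ, LinearMap.sum_apply, Finset.sum_mul, Finset.mul_sum]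
      congr 1
      exact Finset.sum_congr rfl fun k _ => by ring
    rw [h1, h2]
    simp only [hηdef, LinearMap.sub_apply, LinearMap.smul_apply, smul_eq_mul]
    ring
  have hold : ∀ A : Set ι, v ∉ A → Exposes p A →
      Exposes q {x | ∃ i : {i // i ≠ v}, x = .inl i ∧ i.1 ∈ A} := by
    rintro A hvA ⟨φ, h0, h1⟩
    refine ⟨φ, ?_, ?_⟩
    · rintro _ ⟨i, rfl, hi⟩
      exact h0 i hi
    · rintro (i | k) hi
      · exact h1 i fun h => hi ⟨i, rfl, h⟩
      · have := h1 v hvA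
        have h2 : 0 ≤ φ (p (w k)) := by
          by_cases hw : w k ∈ A
          · exact (h0 _ hw).ge
          · exact (h1 _ hw).le
        simp only [hq, truncation_inr, map_add, map_smul, smul_eq_mul]
        positivity
  have hll : ∀ i j, Adj q (.inl i) (.inl j) ↔ Adj p i.1 j.1 := by
    intro i j
    constructor
    · rintro ⟨hij, φ, h0, h1⟩
      refine ⟨fun h => hij (by rw [Subtype.ext h]), φ, ?_, ?_⟩
      · rintro x (rfl | rfl)
        · exact h0 (.inl i) (by simp)
        · exact h0 (.inl j) (by simp)
      · intro x hx
        by_cases hxv : x = v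
        · subst hxv
          have hi : φ (p i) = 0 := h0 (.inl i) (by simp)
          have := hrel φ i
          rw [hi, mul_zero] at this
          have hk : ∀ k, 0 < φ (q (.inr k)) := fun k => h1 _ (by simp)
          have hsum : 0 < ∑ k, β k (p i) * φ (q (.inr k)) := by
            have h3 := hpos i i.2
            rw [hσ, LinearMap.sum_apply] at h3
            obtain ⟨k, -, hk'⟩ := Finset.exists_lt_of_sum_lt
              (s := Finset.univ) (f := fun _ => (0 : ℝ))
              (g := fun k => β k (p i)) (by simpa using h3)
            exact Finset.sum_pos' (fun k _ => mul_nonneg (hβ k i) (hk k).le)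
              ⟨k, Finset.mem_univ k, mul_pos hk' (hk k)⟩
          have h4 := hη i i.2
          by_contra hneg
          nlinarith
        · refine h1 (.inl ⟨x, hxv⟩) ?_
          simp only [mem_insert_iff, mem_singleton_iff, not_or, Sum.inl.injEq] at hx ⊢
          exact ⟨fun h => hx.1 (by rw [← h]), fun h => hx.2 (by rw [← h])⟩
    · rintro ⟨hij, he⟩
      refine ⟨fun h => hij (by rw [Sum.inl.inj h]), ?_⟩
      convert hold _ (by simpa using ⟨i.2.symm, j.2.symm⟩) he using 1
      ext x
      constructor
      · rintro (rfl | rfl)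
        · exact ⟨i, rfl, by simp⟩
        · exact ⟨j, rfl, by simp⟩
      · rintro ⟨x, rfl, (h | h)⟩
        · simp [Subtype.ext h]
        · simp [Subtype.ext (mem_singleton_iff.1 h)]
  have hnew : ∀ K : Set κ, Exposes q (.inr '' K) := by
    intro K
    refine ⟨η + ∑ l, if l ∈ K then 0 else β l, ?_, ?_⟩
    · rintro _ ⟨k, hk, rfl⟩
      rw [LinearMap.add_apply, hηq, LinearMap.sum_apply, zero_add]
      refine Finset.sum_eq_zero fun l _ => ?_
      split_ifs with h
      · simp
      · exact hβq' l k fun h' => h (h' ▸ hk)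
    · rintro (i | k) hi
      · rw [LinearMap.add_apply, LinearMap.sum_apply]
        refine add_pos_of_pos_of_nonneg (hη i i.2) (Finset.sum_nonneg fun l _ => ?_)
        split_ifs
        · simp
        · exact hβ l i
      · have hk : k ∉ K := fun h => hi ⟨k, h, rfl⟩
        rw [LinearMap.add_apply, hηq, LinearMap.sum_apply, zero_add,
          Finset.sum_eq_single k, if_neg hk, hβq]
        · exact hs
        · intro l _ hl
          split_ifs
          · simp
          · exact hβq' l k hl
        · simp
  have hrr : ∀ k l, Adj q (.inr k) (.inr l) ↔ k ≠ l := by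
    intro k l
    refine ⟨fun h h' => h.1 (by rw [h']), fun h => ⟨fun h' => h (Sum.inr.inj h'), ?_⟩⟩
    simpa [Set.image_pair] using hnew {k, l}
  have hrl : ∀ k i, Adj q (.inr k) (.inl i) ↔ i.1 = w k := by
    intro k i
    constructor
    · rintro ⟨-, φ, h0, h1⟩
      by_contra hi
      have hi0 : φ (p i) = 0 := h0 (.inl i) (by simp)
      have hk0 : φ (q (.inr k)) = 0 := h0 (.inr k) (by simp)
      have hw : 0 < φ (p (w k)) := by
        refine h1 (.inl ⟨w k, hwv k⟩) ?_
        simp only [mem_insert_iff, reduceCtorEq, mem_singleton_iff, Sum.inl.injEq, false_or]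
        exact fun h => hi (by rw [← h])
      have hr := hrel φ i
      rw [hi0, mul_zero] at hr
      have hsum : 0 ≤ ∑ l, β l (p i) * φ (q (.inr l)) := by
        refine Finset.sum_nonneg fun l _ => mul_nonneg (hβ l i) ?_
        by_cases hl : l = k
        · rw [hl, hk0]
        · exact (h1 (.inr l) (by simp [hl])).le
      have h4 := hη i i.2
      simp only [hq, truncation_inr, map_add, map_smul, smul_eq_mul] at hk0
      have : 0 < s * φ (p (w k)) := mul_pos hs hw
      nlinarith
    · intro hi
      refine ⟨by simp, ?_⟩
      obtain ⟨-, φ, h0, h1⟩ := hadj k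
      have hv0 : φ (p v) = 0 := h0 v (by simp)
      have hw0 : φ (p (w k)) = 0 := h0 (w k) (by simp)
      refine ⟨φ, ?_, ?_⟩
      · rintro x (rfl | rfl)
        · simp [hq, hv0, hw0]
        · simp [hq, hi, hw0]
      · rintro (j | l) hj
        · refine h1 j ?_
          simp only [mem_insert_iff, reduceCtorEq, mem_singleton_iff, Sum.inl.injEq,
            false_or] at hj
          simp only [mem_insert_iff, mem_singleton_iff, not_or]
          exact ⟨j.2, fun h => hj (Subtype.ext (h.trans hi.symm))⟩
        · have hlk : l ≠ k := by rintro rfl; simp at hj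
          have : 0 < φ (p (w l)) := by
            refine h1 _ ?_
            simp only [mem_insert_iff, mem_singleton_iff, not_or]
            refine ⟨hwv l, fun h => ?_⟩
            have := hβw l k hlk
            rw [← h, hβs] at this
            exact one_ne_zero this
          simp only [hq, truncation_inr, map_add, map_smul, smul_eq_mul, hv0, zero_add]
          positivity
  have hlr : ∀ i k, Adj q (.inl i) (.inr k) ↔ i.1 = w k := fun i k => adj_comm.trans (hrl k i)
  have hnbr : ∀ i, Adj p v i ↔ ∃ k, i = w k := by
    refine fun i => ⟨?_, fun ⟨k, hk⟩ => hk ▸ hadj k⟩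
    rintro ⟨hvi, φ, h0, h1⟩
    by_contra! hi
    have h3 := hpos i hvi.symm
    rw [hσ, LinearMap.sum_apply] at h3
    have hk : ∀ k, 0 < φ (p (w k)) := fun k => h1 _ (by simp [hwv k, (hi k).symm])
    have hz : φ (p i) = 0 := h0 i (by simp)
    rw [hexp i] at hz
    simp only [map_add, map_smul, h0 v (by simp), map_sum, smul_eq_mul, mul_zero,
      zero_add] at hz
    rw [Finset.sum_eq_zero_iff_of_nonneg fun k _ => mul_nonneg (hβ k i) (hk k).le] at hz
    refine h3.ne' (Finset.sum_eq_zero fun k hk' => ?_)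
    exact (mul_eq_zero.1 (hz k hk')).resolve_right (hk k).ne'
  have hwinj : Function.Injective w := by
    intro k l hkl
    by_contra hne
    have := hβw k l hne
    rw [← hkl, hβs] at this
    exact one_ne_zero this
  refine ⟨q, ⟨?_, ?_, ?_⟩, ?_, ⟨.inr k₀, fun l => if l = k₀ then .inl ⟨w k₀, hwv k₀⟩ else .inr l,
    α - s⁻¹ • (σ - β k₀), fun l => if l = k₀ then η else s⁻¹ • β l, ?_, ?_, ?_⟩,
    .inl ⟨w k₀, hwv k₀⟩, .inr, η, fun l => if l = k₀ then α - s⁻¹ • (σ - β k₀) else s⁻¹ • β l,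
    ?_, ?_⟩
  · obtain ⟨φ, -, h⟩ := hp.empty
    refine ⟨φ, by simp, ?_⟩
    rintro (i | k) -
    · exact h i (by simp)
    · have h1 := h v (by simp)
      have h2 := h (w k) (by simp)
      simp only [hq, truncation_inr, map_add, map_smul, smul_eq_mul]
      positivity
  · rintro (i | k)
    · convert hold {i.1} (by simpa using i.2.symm) (hp.singleton i) using 1
      ext x
      simp only [mem_singleton_iff, mem_ofPred_eq]
      exact ⟨fun h => ⟨i, h, rfl⟩, fun ⟨j, h, hj⟩ => by rw [h, Subtype.ext hj]⟩
    · simpa using hnew {k}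
  · rw [eq_top_iff, ← hp.span, Submodule.span_le]
    rintro _ ⟨i, rfl⟩
    by_cases hi : i = v
    · have h1 := Submodule.subset_span (R := ℝ) (mem_range_self (f := q) (.inr k₀))
      have h2 := Submodule.smul_mem _ s
        (Submodule.subset_span (R := ℝ) (mem_range_self (f := q) (.inl ⟨w k₀, hwv k₀⟩)))
      simpa [hq, hi] using Submodule.sub_mem _ h1 h2
    · exact Submodule.subset_span ⟨.inl ⟨i, hi⟩, rfl⟩
  · have e1 : ∀ i, (if Adj p v i then 1 else 0) = ∑ k, if i = w k then 1 else 0 := by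
      intro i
      by_cases hi : ∃ k, i = w k
      · obtain ⟨k, rfl⟩ := hi
        simp [hadj k, hwinj.eq_iff]
      · rw [if_neg (fun h => hi ((hnbr i).1 h)), eq_comm]
        exact Finset.sum_eq_zero fun k _ => if_neg fun h => hi ⟨k, h⟩
    have e1' : ∀ i, (if Adj p i v then 1 else 0) = ∑ k, if i = w k then 1 else 0 := fun i => by
      rw [← e1 i]; simp only [adj_comm (i := i)]
    have e2 : ∀ k, (∑ i : {i // i ≠ v}, if i.1 = w k then 1 else 0) = 1 := by
      intro k
      rw [Finset.sum_eq_single ⟨w k, hwv k⟩ (fun i _ hi => if_neg fun h => hi (Subtype.ext h))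
        (by simp)]
      simp
    have e3 : (∑ i : {i // i ≠ v}, ∑ k, if i.1 = w k then 1 else 0) = Fintype.card κ := by
      rw [Finset.sum_comm]
      simp [e2]
    have e4 : ∀ k : κ, (∑ l, if k ≠ l then 1 else 0) = Fintype.card κ - 1 := by
      intro k
      rw [← Finset.card_filter, Finset.filter_ne, Finset.card_erase_of_mem (Finset.mem_univ k),
        Finset.card_univ]
    have e5 : (∑ k, if v = w k then 1 else 0) = 0 :=
      Finset.sum_eq_zero fun k _ => if_neg (hwv k).symm
    rw [degSum, degSum, Fintype.sum_eq_add_sum_subtype_ne _ v]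
    simp only [Fintype.sum_sum_type, hll, hlr, hrl, hrr, Finset.sum_add_distrib, e3, e4, e2,
      Fintype.sum_eq_add_sum_subtype_ne _ v, e1, e1', e5]
    simp only [Finset.sum_const, Finset.card_univ, smul_eq_mul, mul_one]
    ring
  · refine .of_finrank hE ?_ ?_ ?_ ?_ ?_
    · simp [hqr, hf.apex, hαw, hσv, hσw, hβs, hf.base_apex]
    · intro l
      by_cases hl : l = k₀
      · simp [hql, hl, hαw, hσw, hβs]
      · simp [hqr, hl, hαw, hσw, hσv, hβw k₀ l (Ne.symm hl), hf.apex, hf.base_apex, hs.ne']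
    · intro l
      by_cases hl : l = k₀
      · simp [hqr, hl, hηv, hηw]
      · simp [hqr, hl, hf.base_apex, hβw l k₀ hl]
    · intro l
      by_cases hl : l = k₀
      · simp [hql, hl, hηw]
      · simp [hqr, hl, hf.base_apex, hβs, hs.ne']
    · intro l m hlm
      by_cases hl : l = k₀
      · have hm : m ≠ k₀ := fun h => hlm (hl.trans h.symm)
        simp [hqr, hl, hm, hηw, hηv]
      · by_cases hm : m = k₀
        · simp [hql, hl, hm, hβw l k₀ hl]
        · simp [hqr, hl, hm, hf.base_apex, hβw l m hlm]
  · have hηnn : ∀ x, 0 ≤ η (q x) := by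
      rintro (i | k)
      · exact (hη i i.2).le
      · exact (hηq k).ge
    have hβnn : ∀ l x, 0 ≤ β l (q x) := by
      rintro l (i | k)
      · exact hβ l i
      · by_cases hlk : l = k
        · rw [hlk, hβq]; exact hs.le
        · rw [hβq' l k hlk]
    intro l x
    dsimp only
    split_ifs
    · exact hηnn x
    · rw [LinearMap.smul_apply, smul_eq_mul]
      exact mul_nonneg (inv_nonneg.2 hs.le) (hβnn l x)
  · intro l
    dsimp only
    split_ifs with hl
    · exact (hrl _ _).2 rfl
    · exact (hrr _ _).2 (Ne.symm hl)
  · refine .of_finrank hE ?_ ?_ ?_ ?_ ?_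
    · simp [hql, hηw]
    · exact hηq
    · intro l
      by_cases hl : l = k₀
      · simp [hql, hl, hαw, hσw, hβs]
      · simp [hql, hl, hβw l k₀ hl]
    · intro l
      by_cases hl : l = k₀
      · simp [hqr, hl, hαw, hσw, hβs, hσv, hf.apex, hf.base_apex]
      · simp [hqr, hl, hf.base_apex, hβs, hs.ne']
    · intro l m hlm
      by_cases hl : l = k₀
      · subst hl
        simp [hqr, hαw, hσw, hσv, hβw l m hlm, hf.apex, hf.base_apex, hs.ne']
      · simp [hqr, hl, hf.base_apex, hβw l m hlm]
  · rintro (i | k) hi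
    · exact hη i i.2
    · exact absurd ⟨k, rfl⟩ hi

end Truncation
section Stack

variable {E ι σ : Type*} [AddCommGroup E] [Module ℝ E] [Fintype σ]

/-- Add a new generator just beyond the face spanned by the `p (F k)`, on the side opposite
to `p o`. -/
def stack (p : ι → E) (F : σ → ι) (o : ι) (δ : ℝ) : Option ι → E
  | none => ∑ k, p (F k) - δ • p o
  | some i => p i

@[simp] theorem stack_none (p : ι → E) (F : σ → ι) (o : ι) (δ : ℝ) :
    stack p F o δ none = ∑ k, p (F k) - δ • p o := rfl

@[simp] theorem stack_some (p : ι → E) (F : σ → ι) (o : ι) (δ : ℝ) (i : ι) :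
    stack p F o δ (some i) = p i := rfl

theorem eventually_stack_none_pos {p : ι → E} {F : σ → ι} (o : ι) {φ : E →ₗ[ℝ] ℝ}
    (h0 : ∀ k, 0 ≤ φ (p (F k))) (h1 : ∃ k, 0 < φ (p (F k))) :
    ∀ᶠ δ : ℝ in 𝓝[>] 0, 0 < φ (stack p F o δ none) := by
  have hc : Tendsto (fun δ : ℝ => φ (stack p F o δ none)) (𝓝[>] 0)
      (𝓝 (φ (stack p F o 0 none))) := by
    refine (Continuous.tendsto ?_ 0).mono_left nhdsWithin_le_nhds
    simp only [stack_none, map_sub, map_smul, smul_eq_mul]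
    fun_prop
  refine hc.eventually_const_lt ?_
  obtain ⟨k, hk⟩ := h1
  simpa using Finset.sum_pos' (fun k _ => h0 k) ⟨k, Finset.mem_univ k, hk⟩

theorem Exposes.nonneg {p : ι → E} {A : Set ι} {φ : E →ₗ[ℝ] ℝ} (h0 : ∀ i ∈ A, φ (p i) = 0)
    (h1 : ∀ i ∉ A, 0 < φ (p i)) (i : ι) : 0 ≤ φ (p i) := by
  by_cases hi : i ∈ A
  · exact (h0 i hi).ge
  · exact (h1 i hi).le

theorem Exposes.eventually_stack {p : ι → E} {F : σ → ι} (o : ι) {A : Set ι} (h : Exposes p A)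
    (hF : ∃ k, F k ∉ A) : ∀ᶠ δ : ℝ in 𝓝[>] 0, Exposes (stack p F o δ) (some '' A) := by
  obtain ⟨φ, h0, h1⟩ := h
  obtain ⟨k, hk⟩ := hF
  filter_upwards [eventually_stack_none_pos o (fun k => Exposes.nonneg h0 h1 (F k)) ⟨k, h1 _ hk⟩]
    with δ hδ
  refine ⟨φ, ?_, ?_⟩
  · rintro _ ⟨i, hi, rfl⟩
    exact h0 i hi
  · rintro (_ | i) hi
    · exact hδ
    · exact h1 i fun h => hi ⟨i, h, rfl⟩

theorem Exposes.eventually_insert_none {p : ι → E} {F : σ → ι} {o : ι} {B : Set ι}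
    (h : Exposes p B) (hB : B ⊆ range F) (hF : ∃ k, F k ∉ B) (ho : o ∉ range F)
    (hℓ : Exposes p (range F)) :
    ∀ᶠ δ : ℝ in 𝓝[>] 0, Exposes (stack p F o δ) (insert none (some '' B)) := by
  obtain ⟨φ, h0, h1⟩ := h
  obtain ⟨ℓ, hℓ0, hℓ1⟩ := hℓ
  obtain ⟨k, hk⟩ := hF
  filter_upwards [eventually_stack_none_pos o (fun k => Exposes.nonneg h0 h1 (F k)) ⟨k, h1 _ hk⟩,
    self_mem_nhdsWithin] with δ hδ (hδ0 : 0 < δ)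
  have hℓx : ℓ (stack p F o δ none) = - (δ * ℓ (p o)) := by simp [hℓ0]
  have hpos : 0 < δ * ℓ (p o) := mul_pos hδ0 (hℓ1 o ho)
  refine ⟨φ + (φ (stack p F o δ none) / (δ * ℓ (p o))) • ℓ, ?_, ?_⟩
  · rintro _ (rfl | ⟨i, hi, rfl⟩)
    · rw [LinearMap.add_apply, LinearMap.smul_apply, hℓx, smul_eq_mul, mul_neg,
        div_mul_cancel₀ _ hpos.ne', add_neg_cancel]
    · simp [h0 i hi, hℓ0 i (hB hi)]
  · rintro (_ | i) hi
    · exact absurd (mem_insert _ _) hi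
    · rw [LinearMap.add_apply, LinearMap.smul_apply, smul_eq_mul]
      exact add_pos_of_pos_of_nonneg (h1 i fun h => hi (Or.inr ⟨i, h, rfl⟩))
        (mul_nonneg (div_pos hδ hpos).le (Exposes.nonneg hℓ0 hℓ1 i))

theorem eventually_not_adj_stack {p : ι → E} {F : σ → ι} {o w : ι} [Nonempty σ]
    (hw : w ∉ range F) (h : ∃ c : ℝ, 0 < c ∧ ∃ a : σ → ℝ, p w = c • p o + ∑ k, a k • p (F k)) :
    ∀ᶠ δ : ℝ in 𝓝[>] 0, ¬ Adj (stack p F o δ) none (some w) := by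
  obtain ⟨c, hc, a, ha⟩ := h
  have hpos : ∀ᶠ δ : ℝ in 𝓝[>] 0, ∀ k, 0 < c + δ * a k := by
    rw [Filter.eventually_all]
    intro k
    have ht : Tendsto (fun δ : ℝ => c + δ * a k) (𝓝[>] 0) (𝓝 (c + 0 * a k)) := by
      refine (Continuous.tendsto ?_ 0).mono_left nhdsWithin_le_nhds
      fun_prop
    exact ht.eventually_const_lt (by simpa using hc)
  filter_upwards [hpos] with δ hδ
  rintro ⟨-, φ, h0, h1⟩
  have hx : φ (stack p F o δ none) = 0 := h0 none (by simp)
  have hw0 : φ (p w) = 0 := h0 (some w) (by simp)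
  have hk : ∀ k, 0 < φ (p (F k)) := by
    refine fun k => h1 (some (F k)) ?_
    simp only [mem_insert_iff, reduceCtorEq, mem_singleton_iff, Option.some.injEq, false_or]
    exact fun h => hw ⟨k, h⟩
  have hsum : 0 < ∑ k, (c + δ * a k) * φ (p (F k)) :=
    Finset.sum_pos (fun k _ => mul_pos (hδ k) (hk k)) Finset.univ_nonempty
  refine hsum.ne' ?_
  rw [ha] at hw0
  simp only [stack_none, map_sub, map_add, map_smul, map_sum, smul_eq_mul] at hx hw0
  simp only [add_mul, Finset.sum_add_distrib, mul_assoc, ← Finset.mul_sum]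
  linear_combination c * hx + δ * hw0

theorem IsPointed.eventually_stack [Finite ι] {p : ι → E} (hp : IsPointed p) {F : σ → ι} {o : ι}
    (hinj : Function.Injective F) (hcard : 3 ≤ Fintype.card σ) (ho : o ∉ range F)
    (hℓ : Exposes p (range F))
    (hexp : ∀ i ∉ range F, ∃ c : ℝ, 0 < c ∧ ∃ a : σ → ℝ, p i = c • p o + ∑ k, a k • p (F k)) :
    ∀ᶠ δ : ℝ in 𝓝[>] 0, IsPointed (stack p F o δ) ∧
      (∀ i j, Adj (stack p F o δ) (some i) (some j) ↔ Adj p i j) ∧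
      ∀ i, Adj (stack p F o δ) none (some i) ↔ i ∈ range F := by
  classical
  have : Nonempty σ := Fintype.card_pos_iff.1 (by omega)
  have hout : ∀ i j : ι, ∃ k, F k ∉ ({i, j} : Set ι) := by
    intro i j
    by_contra! h
    have h1 : Finset.univ.image F ⊆ {i, j} := by
      intro x hx
      obtain ⟨k, -, rfl⟩ := Finset.mem_image.1 hx
      simpa using h k
    have h2 := Finset.card_le_card h1
    rw [Finset.card_image_of_injective _ hinj, Finset.card_univ] at h2
    have := Finset.card_le_two (a := i) (b := j)
    omega
  have e1 : ∀ᶠ δ : ℝ in 𝓝[>] 0, ∀ i j, Adj p i j → Adj (stack p F o δ) (some i) (some j) := by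
    simp_rw [Filter.eventually_all]
    rintro i j ⟨hij, h⟩
    filter_upwards [h.eventually_stack o (hout i j)] with δ hδ
    exact ⟨by simpa using hij, by simpa [Set.image_pair] using hδ⟩
  have e2 : ∀ᶠ δ : ℝ in 𝓝[>] 0, ∀ i, Exposes (stack p F o δ) {some i} := by
    rw [Filter.eventually_all]
    intro i
    filter_upwards [(hp.singleton i).eventually_stack o (by simpa using hout i i)] with δ hδ
    simpa using hδ
  have e3 : ∀ᶠ δ : ℝ in 𝓝[>] 0, ∀ k, Adj (stack p F o δ) none (some (F k)) := by
    rw [Filter.eventually_all]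
    intro k
    filter_upwards [(hp.singleton (F k)).eventually_insert_none (by simp)
      (by simpa using hout (F k) (F k)) ho hℓ] with δ hδ
    exact ⟨by simp, by simpa using hδ⟩
  have e4 : ∀ᶠ δ : ℝ in 𝓝[>] 0, ∀ w, w ∉ range F → ¬ Adj (stack p F o δ) none (some w) := by
    simp_rw [Filter.eventually_all]
    exact fun w hw => eventually_not_adj_stack hw (hexp w hw)
  filter_upwards [e1, e2, e3, e4, hp.empty.eventually_stack (F := F) o (by simp),
    hp.empty.eventually_insert_none (by simp) (by simp) ho hℓ] with δ h1 h2 h3 h4 h5 h6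
  refine ⟨⟨by simpa using h5, ?_, ?_⟩, fun i j => ⟨?_, h1 i j⟩, fun i => ⟨?_, ?_⟩⟩
  · rintro (_ | i)
    · simpa using h6
    · exact h2 i
  · rw [eq_top_iff, ← hp.span]
    refine Submodule.span_mono ?_
    rintro _ ⟨i, rfl⟩
    exact ⟨some i, rfl⟩
  · rintro ⟨hij, φ, h0, h1⟩
    refine ⟨by simpa using hij, φ, ?_, fun x hx => h1 (some x) (by simpa using hx)⟩
    rintro x (rfl | rfl)
    · exact h0 (some x) (by simp)
    · exact h0 (some x) (by simp)
  · intro h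
    by_contra hi
    exact h4 i hi h
  · rintro ⟨k, rfl⟩
    exact h3 k

theorem IsSimplexFacet.eventually_stack {κ : Type*} [Fintype κ] {p : ι → E} {F : σ → ι} (o : ι)
    {o' : ι} {G : κ → ι} (h : IsSimplexFacet p o' G) (hF : ∃ k, F k ∉ range G) :
    ∀ᶠ δ : ℝ in 𝓝[>] 0, IsSimplexFacet (stack p F o δ) (some o') (some ∘ G) := by
  obtain ⟨α, β, hf, hn⟩ := h
  obtain ⟨k, hk⟩ := hF
  have h0 : ∀ i ∈ range G, α (p i) = 0 := by
    rintro _ ⟨k, rfl⟩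
    exact hf.apex_base k
  filter_upwards [eventually_stack_none_pos o (fun k => Exposes.nonneg h0 hn (F k)) ⟨k, hn _ hk⟩]
    with δ hδ
  refine ⟨α, β, hf, ?_⟩
  rintro (_ | i) hi
  · exact hδ
  · exact hn i fun ⟨k, hk⟩ => hi ⟨k, by simp [hk]⟩

open Classical in
theorem exists_stack_simplex [Fintype ι] {p : ι → E} (hp : IsPointed p) {o : ι} {F : σ → ι}
    (hF : IsSimplexFacet p o F) (hE : Module.finrank ℝ E = Fintype.card σ + 1)
    (hcard : 3 ≤ Fintype.card σ) :
    ∃ q : Option ι → E, IsPointed q ∧ degSum q = degSum p + 2 * Fintype.card σ ∧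
      ∃ o' F', IsSimplexFacet (κ := σ) q o' F' := by
  obtain ⟨α, β, hf, hn⟩ := hF
  have hα : ∀ k, α (p (F k)) = 0 := hf.apex_base
  have hβs : ∀ k, β k (p (F k)) = 1 := hf.base_self
  have hβn : ∀ k l, k ≠ l → β k (p (F l)) = 0 := hf.base_ne
  have hinj : Function.Injective F := by
    intro k l hkl
    by_contra hne
    have := hβn k l hne
    rw [← hkl, hβs] at this
    exact one_ne_zero this
  have ho : o ∉ range F := by
    rintro ⟨k, rfl⟩
    exact one_ne_zero (hf.apex.symm.trans (hα k))
  obtain ⟨k₀⟩ : Nonempty σ := Fintype.card_pos_iff.1 (by omega)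
  have hpos : ∀ᶠ δ : ℝ in 𝓝[>] 0, ∀ i, i ∉ range F → 0 < δ * β k₀ (p i) + α (p i) := by
    simp_rw [Filter.eventually_all]
    intro i hi
    have ht : Tendsto (fun δ : ℝ => δ * β k₀ (p i) + α (p i)) (𝓝[>] 0)
        (𝓝 (0 * β k₀ (p i) + α (p i))) := by
      refine (Continuous.tendsto ?_ 0).mono_left nhdsWithin_le_nhds
      fun_prop
    exact ht.eventually_const_lt (by simpa using hn i hi)
  obtain ⟨δ, ⟨hq, hss, hns⟩, hδ, hδ0 : 0 < δ⟩ := ((hp.eventually_stack hinj hcard ho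
    ⟨α, by rintro _ ⟨k, rfl⟩; exact hα k, hn⟩
    fun i hi => ⟨α (p i), hn i hi, fun k => β k (p i), hf.expand (p i)⟩).and
      (hpos.and self_mem_nhdsWithin)).exists
  have hxα : α (stack p F o δ none) = -δ := by simp [hα, hf.apex]
  have hxβ : ∀ l, β l (stack p F o δ none) = 1 := by
    intro l
    rw [stack_none, map_sub, map_smul, map_sum, hf.base_apex,
      Finset.sum_eq_single l (fun k _ hk => hβn l k hk.symm) (by simp), hβs]
    simp
  refine ⟨stack p F o δ, hq, ?_, some (F k₀), fun l => if l = k₀ then none else some (F l),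
    β k₀ + δ⁻¹ • α, fun l => if l = k₀ then -δ⁻¹ • α else β l + δ⁻¹ • α, ?_, ?_⟩
  · rw [degSum_option (Finset.univ.image F) hss (by simpa using hns),
      Finset.card_image_of_injective _ hinj, Finset.card_univ]
  · refine .of_finrank hE ?_ ?_ ?_ ?_ ?_
    · simp [hβs, hα]
    · intro l
      by_cases hl : l = k₀
      · simp [hl, -stack_none, hxα, hxβ, hδ0.ne']
      · simp [hl, hα, hβn k₀ l (Ne.symm hl)]
    · intro l
      by_cases hl : l = k₀
      · simp [hl, hα]
      · simp [hl, hα, hβn l k₀ hl]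
    · intro l
      by_cases hl : l = k₀
      · simp [hl, -stack_none, hxα, hδ0.ne']
      · simp [hl, hα, hβs]
    · intro l m hlm
      by_cases hm : m = k₀
      · have hl : l ≠ k₀ := fun h => hlm (h.trans hm.symm)
        simp [hl, hm, -stack_none, hxα, hxβ, hδ0.ne']
      · by_cases hl : l = k₀
        · simp [hl, hm, hα]
        · simp [hl, hm, hα, hβn l m hlm]
  · rintro (_ | i) hi
    · exact absurd ⟨k₀, by simp⟩ hi
    · by_cases hiF : i ∈ range F
      · obtain ⟨k, rfl⟩ := hiF
        have hk : k = k₀ := by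
          by_contra hk
          exact hi ⟨k, by simp [hk]⟩
        simp [hk, hβs, hα]
      · have h1 := mul_pos (inv_pos.2 hδ0) (hδ i hiF)
        rw [mul_add, inv_mul_cancel_left₀ hδ0.ne'] at h1
        simpa using h1

end Stack
section Combinatorial

/-- There is a `d`-dimensional configuration with `n` vertices, degree sum `s` and a simplex
facet. -/
def HasFacet (d n s : ℕ) : Prop :=
  ∃ (E ι κ : Type) (_ : AddCommGroup E) (_ : Module ℝ E) (_ : Fintype ι) (_ : Fintype κ)
    (p : ι → E), Module.finrank ℝ E = d + 1 ∧ Fintype.card ι = n ∧ Fintype.card κ = d ∧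
      IsPointed p ∧ degSum p = s ∧ ∃ o F, IsSimplexFacet (κ := κ) p o F

/-- There is a `d`-dimensional configuration with `n` vertices, degree sum `s`, a simple vertex
and a simplex facet. -/
def HasVertexAndFacet (d n s : ℕ) : Prop :=
  ∃ (E ι κ : Type) (_ : AddCommGroup E) (_ : Module ℝ E) (_ : Fintype ι) (_ : Fintype κ)
    (p : ι → E), Module.finrank ℝ E = d + 1 ∧ Fintype.card ι = n ∧ Fintype.card κ = d ∧
      IsPointed p ∧ degSum p = s ∧ (∃ v w, IsSimpleVertex (κ := κ) p v w) ∧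
      ∃ o F, IsSimplexFacet (κ := κ) p o F

theorem HasVertexAndFacet.hasFacet {d n s : ℕ} (h : HasVertexAndFacet d n s) :
    HasFacet d n s := by
  obtain ⟨E, ι, κ, _, _, _, _, p, hE, hι, hκ, hp, hs, -, hF⟩ := h
  exact ⟨E, ι, κ, _, _, _, _, p, hE, hι, hκ, hp, hs, hF⟩

theorem HasFacet.stack {d n s : ℕ} (hd : 3 ≤ d) (h : HasFacet d n s) :
    HasFacet d (n + 1) (s + 2 * d) := by
  obtain ⟨E, ι, κ, _, _, _, _, p, hE, rfl, rfl, hp, rfl, o, F, hF⟩ := h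
  obtain ⟨q, hq, hs, hF'⟩ := exists_stack_simplex hp hF hE hd
  exact ⟨E, Option ι, κ, _, _, _, _, q, hE, Fintype.card_option, rfl, hq, hs, hF'⟩

theorem HasVertexAndFacet.pyramid {d n s : ℕ} (h : HasVertexAndFacet d n s) :
    HasVertexAndFacet (d + 1) (n + 1) (s + 2 * n) := by
  obtain ⟨E, ι, κ, _, _, _, _, p, hE, rfl, rfl, hp, rfl, ⟨v, w, hv⟩, o, F, hF⟩ := h
  have : FiniteDimensional ℝ E := FiniteDimensional.of_finrank_pos (by omega)
  exact ⟨E × ℝ, Option ι, Option κ, _, _, _, _, ConeConfig.pyramid p, by simp [hE],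
    Fintype.card_option, Fintype.card_option, hp.pyramid, degSum_pyramid hp,
    ⟨_, _, hv.pyramid hp⟩, _, _, hF.pyramid⟩

open Classical in
theorem HasVertexAndFacet.truncation {d n s : ℕ} (hd : 1 ≤ d) (h : HasVertexAndFacet d n s) :
    HasVertexAndFacet d (n + d - 1) (s + d * (d - 1)) := by
  obtain ⟨E, ι, κ, _, _, _, _, p, hE, rfl, rfl, hp, rfl, ⟨v, w, hv⟩, -⟩ := h
  obtain ⟨k₀⟩ : Nonempty κ := Fintype.card_pos_iff.1 (by omega)
  obtain ⟨q, hq, hs, hv', hF'⟩ := exists_truncation hp hv hE k₀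
  have hι : 0 < Fintype.card ι := Fintype.card_pos_iff.2 ⟨v⟩
  refine ⟨E, {i // i ≠ v} ⊕ κ, κ, _, _, _, _, q, hE, ?_, rfl, hq, hs, hv', hF'⟩
  rw [Fintype.card_sum, Fintype.card_subtype_compl, Fintype.card_subtype_eq]
  omega

theorem hasVertexAndFacet_point : HasVertexAndFacet 0 1 0 := by
  have hf : IsDualFrame (1 : ℝ) ((fun _ : Unit => (1 : ℝ)) ∘ Empty.elim) LinearMap.id
      (fun k : Empty => k.elim) :=
    ⟨rfl, nofun, nofun, nofun, nofun, by simp⟩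
  refine ⟨ℝ, Unit, Empty, inferInstance, inferInstance, inferInstance, inferInstance, fun _ => 1,
    by simp, rfl, rfl, ⟨⟨LinearMap.id, by simp, by simp⟩, fun i => ⟨0, by simp, by simp⟩, ?_⟩, ?_,
    ⟨(), Empty.elim, _, _, hf, nofun, nofun⟩, (), Empty.elim, _, _, hf, by simp⟩
  · rw [eq_top_iff]
    intro x _
    simp
  · simp [degSum, not_adj_self]

/-- The triangle, obtained as an iterated pyramid over a point. -/
theorem hasVertexAndFacet_triangle : HasVertexAndFacet 2 3 6 :=
  hasVertexAndFacet_point.pyramid.pyramid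

theorem hasVertexAndFacet_polygon (m : ℕ) : HasVertexAndFacet 2 (m + 3) (2 * (m + 3)) := by
  induction m with
  | zero => exact hasVertexAndFacet_triangle
  | succ m ih => exact ih.truncation (by norm_num)

/-- Truncating `a` times and then stacking `b` times. -/
theorem HasVertexAndFacet.iterate {n s : ℕ} (h : HasVertexAndFacet 5 n s) (a b : ℕ) :
    HasFacet 5 (n + 4 * a + b) (s + 20 * a + 10 * b) := by
  have h1 : HasVertexAndFacet 5 (n + 4 * a) (s + 20 * a) := by
    induction a with
    | zero => exact h
    | succ a ih => exact ih.truncation (by norm_num)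
  induction b with
  | zero => exact h1.hasFacet
  | succ b ih => exact ih.stack (by norm_num)

theorem HasFacet.iterate_stack {n s : ℕ} (h : HasFacet 5 n s) (b : ℕ) :
    HasFacet 5 (n + b) (s + 10 * b) := by
  induction b with
  | zero => exact h
  | succ b ih => exact ih.stack (by norm_num)

theorem hasFacet_of_le {n e : ℕ} (h1 : 5 * n + 5 < 2 * e) (h2 : e + 16 ≤ 5 * n) :
    HasFacet 5 n (2 * e) := by
  have tri := hasVertexAndFacet_triangle
  have q4 := hasVertexAndFacet_polygon 1
  have q5 := hasVertexAndFacet_polygon 2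
  have q6 := hasVertexAndFacet_polygon 3
  have b23 : HasVertexAndFacet 5 8 46 := q5.pyramid.pyramid.pyramid
  have b28 : HasVertexAndFacet 5 10 56 :=
    (q4.pyramid.pyramid.truncation (by norm_num)).pyramid
  have b26 : HasVertexAndFacet 5 9 52 :=
    (q4.pyramid.truncation (by norm_num)).pyramid.pyramid
  have b31 : HasVertexAndFacet 5 11 62 :=
    ((tri.pyramid.truncation (by norm_num)).pyramid.truncation (by norm_num)).pyramid
  have b19 : HasVertexAndFacet 5 7 38 := q4.pyramid.pyramid.pyramid
  have b29 : HasVertexAndFacet 5 10 58 :=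
    ((tri.pyramid.truncation (by norm_num)).truncation (by norm_num)).pyramid.pyramid
  have b27 : HasVertexAndFacet 5 9 54 := q6.pyramid.pyramid.pyramid
  have b32 : HasVertexAndFacet 5 11 64 :=
    (q5.pyramid.pyramid.truncation (by norm_num)).pyramid
  have b30 : HasVertexAndFacet 5 10 60 :=
    (q5.pyramid.truncation (by norm_num)).pyramid.pyramid
  have b35 : HasVertexAndFacet 5 12 70 :=
    ((q4.pyramid.truncation (by norm_num)).pyramid.truncation (by norm_num)).pyramid
  have key : ∀ {m s a b : ℕ}, HasVertexAndFacet 5 m s → n = m + 4 * a + b →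
      2 * e = s + 20 * a + 10 * b → HasFacet 5 n (2 * e) := by
    rintro m s a b h rfl he
    rw [he]
    exact h.iterate a b
  obtain ⟨r, hr⟩ : ∃ r, 5 * n = e + 16 + r := ⟨_, (Nat.add_sub_cancel' h2).symm⟩
  obtain ⟨a, c, hc, rfl⟩ : ∃ a c, c < 10 ∧ r = 10 * a + c :=
    ⟨r / 10, r % 10, Nat.mod_lt _ (by norm_num), (Nat.div_add_mod r 10).symm⟩
  interval_cases c
  all_goals first
  | exact key (a := a) (b := n - 7 - 4 * a) b19 (by omega) (by omega)
  | exact key (a := a) (b := n - 8 - 4 * a) b23 (by omega) (by omega)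
  | exact key (a := a) (b := n - 10 - 4 * a) b28 (by omega) (by omega)
  | exact key (a := a) (b := n - 9 - 4 * a) b26 (by omega) (by omega)
  | exact key (a := a) (b := n - 11 - 4 * a) b31 (by omega) (by omega)
  | exact key (a := a) (b := n - 10 - 4 * a) b29 (by omega) (by omega)
  | exact key (a := a) (b := n - 9 - 4 * a) b27 (by omega) (by omega)
  | exact key (a := a) (b := n - 11 - 4 * a) b32 (by omega) (by omega)
  | exact key (a := a) (b := n - 10 - 4 * a) b30 (by omega) (by omega)
  | exact key (a := a) (b := n - 12 - 4 * a) b35 (by omega) (by omega)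

end Combinatorial
section Neighborly

theorem IsDualFrame.swap {E κ : Type*} [AddCommGroup E] [Module ℝ E] [Fintype κ] [DecidableEq κ]
    {u₀ : E} {u : κ → E} {α : E →ₗ[ℝ] ℝ} {β : κ → E →ₗ[ℝ] ℝ} (h : IsDualFrame u₀ u α β)
    (hE : Module.finrank ℝ E = Fintype.card κ + 1) (k : κ) :
    IsDualFrame (u k) (Function.update u k u₀) (β k) (Function.update β k α) := by
  refine .of_finrank hE (h.base_self k) ?_ ?_ ?_ ?_
  · intro l
    by_cases hl : l = k
    · subst hl
      simpa using h.base_apex l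
    · simpa [hl] using h.base_ne k l (Ne.symm hl)
  · intro l
    by_cases hl : l = k
    · subst hl
      simpa using h.apex_base l
    · simpa [hl] using h.base_ne l k hl
  · intro l
    by_cases hl : l = k
    · subst hl
      simpa using h.apex
    · simpa [hl] using h.base_self l
  · intro l m hlm
    by_cases hl : l = k
    · subst hl
      simpa [hlm.symm] using h.apex_base m
    · by_cases hm : m = k
      · subst hm
        simpa [hl] using h.base_apex l
      · simpa [hl, hm] using h.base_ne l m hlm

theorem degSum_of_forall_adj {E ι : Type*} [AddCommGroup E] [Module ℝ E] [Fintype ι] {p : ι → E}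
    (h : ∀ i j, i ≠ j → Adj p i j) : degSum p = Fintype.card ι * (Fintype.card ι - 1) := by
  classical
  have hadj : ∀ i j, Adj p i j ↔ i ≠ j := fun i j => ⟨fun h => h.1, h i j⟩
  have hsum : ∀ i : ι, (∑ j, if i ≠ j then 1 else 0) = Fintype.card ι - 1 := by
    intro i
    rw [← Finset.card_filter, Finset.filter_ne, Finset.card_erase_of_mem (Finset.mem_univ i),
      Finset.card_univ]
  simp only [degSum, hadj, hsum, Finset.sum_const, Finset.card_univ, smul_eq_mul]

/-- The Lagrange basis polynomials for the nodes `0, 1, 2, 3, 4`. -/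
noncomputable def lagrange (t : ℝ) : Fin 5 → ℝ :=
  ![(t - 1) * (t - 2) * (t - 3) * (t - 4) / 24, -(t * (t - 2) * (t - 3) * (t - 4)) / 6,
    t * (t - 1) * (t - 3) * (t - 4) / 4, -(t * (t - 1) * (t - 2) * (t - 4)) / 6,
    t * (t - 1) * (t - 2) * (t - 3) / 24]

theorem lagrange_node (j : Fin 5) : lagrange (j : ℕ) = Pi.single j 1 := by
  ext i
  fin_cases j <;> fin_cases i <;> norm_num [lagrange, Pi.single_apply]

theorem sum_lagrange (a b t : ℝ) :
    ∑ j : Fin 5, (((j : ℕ) : ℝ) - a) ^ 2 * (((j : ℕ) : ℝ) - b) ^ 2 * lagrange t j =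
      (t - a) ^ 2 * (t - b) ^ 2 := by
  simp [Fin.sum_univ_five, lagrange]
  ring

theorem lagrange_four_pos {t : ℕ} (ht : 4 ≤ t) : 0 < lagrange t 4 := by
  have h : (4 : ℝ) ≤ t := by exact_mod_cast ht
  have h0 : (0 : ℝ) < t := by linarith
  have h1 : (0 : ℝ) < t - 1 := by linarith
  have h2 : (0 : ℝ) < t - 2 := by linarith
  have h3 : (0 : ℝ) < t - 3 := by linarith
  simp only [lagrange, Matrix.cons_val]
  positivity

/-- Points on the moment curve of order four, lifted in such a way that the first `k` of them span
a face. -/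
noncomputable def liftedCurve (m k : ℕ) (t : Fin m) : (Fin 5 → ℝ) × ℝ :=
  (lagrange (t : ℕ), lagrange (t : ℕ) 4 * ((t + 1 - k : ℕ) : ℝ))

variable {m k : ℕ}

theorem exposes_liftedCurve (a b : Fin m) : Exposes (liftedCurve m k) {a, b} := by
  obtain ⟨φ, key⟩ : ∃ φ : (Fin 5 → ℝ) × ℝ →ₗ[ℝ] ℝ, ∀ t, φ (liftedCurve m k t) =
      ((t : ℕ) - (a : ℕ) : ℝ) ^ 2 * ((t : ℕ) - (b : ℕ) : ℝ) ^ 2 := by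
    refine ⟨∑ j : Fin 5, ((((j : ℕ) : ℝ) - (a : ℕ)) ^ 2 * (((j : ℕ) : ℝ) - (b : ℕ)) ^ 2) •
      (LinearMap.proj j ∘ₗ LinearMap.fst ℝ (Fin 5 → ℝ) ℝ), fun t => ?_⟩
    rw [← sum_lagrange]
    simp [liftedCurve, LinearMap.sum_apply]
  refine ⟨φ, fun t ht => ?_, fun t ht => ?_⟩
  · rw [key]
    rcases ht with rfl | rfl <;> simp
  · rw [key]
    simp only [mem_insert_iff, mem_singleton_iff, not_or] at ht
    have h1 : ((t : ℕ) - (a : ℕ) : ℝ) ≠ 0 :=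
      sub_ne_zero.2 fun h => ht.1 (Fin.ext (by exact_mod_cast h))
    have h2 : ((t : ℕ) - (b : ℕ) : ℝ) ≠ 0 :=
      sub_ne_zero.2 fun h => ht.2 (Fin.ext (by exact_mod_cast h))
    positivity

theorem liftedCurve_snd_pos (hk : 5 ≤ k) {t : Fin m} (ht : k ≤ t) :
    0 < (liftedCurve m k t).2 := by
  have : (0 : ℝ) < ((t + 1 - k : ℕ) : ℝ) := by
    exact_mod_cast (by omega : 0 < (t : ℕ) + 1 - k)
  exact mul_pos (lagrange_four_pos (by omega)) this

theorem liftedCurve_snd_eq_zero {t : Fin m} (ht : (t : ℕ) < k) : (liftedCurve m k t).2 = 0 := by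
  simp [liftedCurve, Nat.sub_eq_zero_of_le (Nat.succ_le_of_lt ht)]

theorem isDualFrame_liftedCurve (hk : 5 ≤ k) (hm : 5 ≤ m) {o : Fin m} (ho : k ≤ o) :
    IsDualFrame (liftedCurve m k o) (liftedCurve m k ∘ Fin.castLE hm)
      ((liftedCurve m k o).2⁻¹ • LinearMap.snd ℝ (Fin 5 → ℝ) ℝ)
      fun j => LinearMap.proj j ∘ₗ LinearMap.fst ℝ (Fin 5 → ℝ) ℝ -
        (lagrange (o : ℕ) j / (liftedCurve m k o).2) • LinearMap.snd ℝ (Fin 5 → ℝ) ℝ := by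
  have h0 := (liftedCurve_snd_pos hk ho).ne'
  have h1 : ∀ j : Fin 5, liftedCurve m k (Fin.castLE hm j) = (Pi.single j 1, 0) := by
    intro j
    refine Prod.ext ?_ (liftedCurve_snd_eq_zero (by simp; omega))
    simpa [liftedCurve] using lagrange_node j
  refine .of_finrank (by simp) ?_ ?_ ?_ ?_ ?_
  · simp [h0]
  · simp [h1]
  · intro j
    simp only [LinearMap.sub_apply, LinearMap.smul_apply, LinearMap.snd_apply, smul_eq_mul,
      div_mul_cancel₀ _ h0]
    simp [liftedCurve]
  · simp [h1]
  · intro j l hjl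
    simp [h1, hjl]

theorem isPointed_liftedCurve (hk : 5 ≤ k) (hm : k < m) : IsPointed (liftedCurve m k) where
  empty := by
    refine ⟨∑ j, LinearMap.proj j ∘ₗ LinearMap.fst ℝ (Fin 5 → ℝ) ℝ, by simp, fun t _ => ?_⟩
    have : ∀ t, ∑ j, lagrange t j = 1 := by
      intro t
      simp [Fin.sum_univ_five, lagrange]
      ring
    simp [liftedCurve, LinearMap.sum_apply, this]
  singleton t := by simpa using exposes_liftedCurve t t
  span := by
    rw [eq_top_iff]
    intro x _
    rw [(isDualFrame_liftedCurve hk (by omega) (o := ⟨k, hm⟩) le_rfl).expand x]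
    exact Submodule.add_mem _ (Submodule.smul_mem _ _ (Submodule.subset_span ⟨_, rfl⟩))
      (Submodule.sum_mem _ fun j _ => Submodule.smul_mem _ _ (Submodule.subset_span ⟨_, rfl⟩))

theorem adj_liftedCurve {a b : Fin m} (h : a ≠ b) : Adj (liftedCurve m k) a b :=
  ⟨h, exposes_liftedCurve a b⟩

theorem degSum_liftedCurve : degSum (liftedCurve m k) = m * (m - 1) := by
  simpa using degSum_of_forall_adj fun i j => adj_liftedCurve (m := m) (k := k) (a := i) (b := j)

theorem isSimplexFacet_liftedCurve (hk : 5 ≤ k) (hm : k < m) :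
    IsSimplexFacet (liftedCurve m k) (⟨4, by omega⟩ : Fin m)
      (Function.update (Fin.castLE (by omega : 5 ≤ m)) 4 ⟨m - 1, by omega⟩) := by
  have hf := (isDualFrame_liftedCurve hk (by omega : 5 ≤ m) (o := ⟨m - 1, by omega⟩)
    (by simp; omega)).swap (by simp) 4
  rw [← Function.comp_update] at hf
  refine ⟨_, _, hf, fun t ht => ?_⟩
  have ht1 : (t : ℕ) + 1 < m := by
    refine lt_of_le_of_ne t.2 fun h => ht ⟨4, ?_⟩
    ext
    simp
    omega
  have ht4 : 4 ≤ (t : ℕ) := by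
    by_contra h
    refine ht ⟨⟨t, by omega⟩, ?_⟩
    rw [Function.update_of_ne]
    · rfl
    · intro h'
      have := congrArg Fin.val h'
      simp at this
      omega
  have hL : lagrange ((m - 1 : ℕ) : ℝ) 4 ≠ 0 := (lagrange_four_pos (by omega)).ne'
  have hmk : (0 : ℝ) < ((m - k : ℕ) : ℝ) := by exact_mod_cast (by omega : 0 < m - k)
  have hlt : ((t + 1 - k : ℕ) : ℝ) < ((m - k : ℕ) : ℝ) := by
    exact_mod_cast (by omega : (t : ℕ) + 1 - k < m - k)
  have hm1 : m - 1 + 1 - k = m - k := by omega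
  have : 0 < lagrange (t : ℕ) 4 * (1 - ((t + 1 - k : ℕ) : ℝ) / ((m - k : ℕ) : ℝ)) :=
    mul_pos (lagrange_four_pos ht4) (sub_pos.2 ((div_lt_one hmk).2 hlt))
  convert this using 1
  simp only [liftedCurve, hm1, LinearMap.sub_apply, LinearMap.smul_apply, LinearMap.comp_apply,
    LinearMap.proj_apply, LinearMap.fst_apply, LinearMap.snd_apply, smul_eq_mul]
  field_simp

theorem hasFacet_neighborly (hm : 6 ≤ m) : HasFacet 5 m (m * (m - 1)) :=
  ⟨(Fin 5 → ℝ) × ℝ, Fin m, Fin 5, _, _, _, _, liftedCurve m 5, by simp, by simp, by simp,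
    isPointed_liftedCurve le_rfl hm,
    degSum_liftedCurve, _, _, isSimplexFacet_liftedCurve le_rfl hm⟩

theorem hasFacet_neighborly_stack (hk : 5 ≤ k) (hm : k < m) :
    HasFacet 5 (m + 1) (m * (m - 1) + 2 * k) := by
  have hp := isPointed_liftedCurve hk hm
  have hmem : ∀ i : Fin m, i ∈ range (Fin.castLE hm.le) ↔ (i : ℕ) < k := by
    intro i
    constructor
    · rintro ⟨j, rfl⟩
      exact j.2
    · exact fun h => ⟨⟨i, h⟩, rfl⟩
  have hinj : Function.Injective (Fin.castLE hm.le) := Fin.castLE_injective hm.le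
  obtain ⟨α, β, hα, hf⟩ : ∃ α β, α = (liftedCurve m k ⟨k, hm⟩).2⁻¹ • LinearMap.snd ℝ (Fin 5 → ℝ) ℝ ∧
      IsDualFrame (liftedCurve m k ⟨k, hm⟩) (liftedCurve m k ∘ Fin.castLE (hk.trans hm.le)) α β :=
    ⟨_, _, rfl, isDualFrame_liftedCurve hk (hk.trans hm.le) le_rfl⟩
  have hexp : ∀ i ∉ range (Fin.castLE hm.le), ∃ c : ℝ, 0 < c ∧ ∃ a : Fin k → ℝ,
      liftedCurve m k i = c • liftedCurve m k ⟨k, hm⟩ +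
        ∑ j, a j • liftedCurve m k (Fin.castLE hm.le j) := by
    intro i hi
    refine ⟨α (liftedCurve m k i), ?_, Function.extend (Fin.castLE hk)
      (fun j => β j (liftedCurve m k i)) 0, (hf.expand _).trans (congrArg _
        (Fintype.sum_of_injective (Fin.castLE hk) (Fin.castLE_injective hk) _ _ ?_ ?_))⟩
    · rw [hα]
      exact mul_pos (inv_pos.2 (liftedCurve_snd_pos hk le_rfl))
        (liftedCurve_snd_pos hk (not_lt.1 ((hmem i).not.1 hi)))
    · intro j hj
      rw [Function.extend_apply' _ _ _ hj]
      simp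
    · intro j
      rw [(Fin.castLE_injective hk).extend_apply]
      rfl
  have hout : ∃ j, Fin.castLE hm.le j ∉
      range (Function.update (Fin.castLE (by omega : 5 ≤ m)) 4 ⟨m - 1, by omega⟩) := by
    refine ⟨⟨4, by omega⟩, ?_⟩
    rintro ⟨j, hj⟩
    have h := congrArg Fin.val hj
    by_cases hj4 : j = 4
    · simp [hj4] at h
      omega
    · simp [hj4] at h
      exact hj4 (Fin.ext h)
  obtain ⟨δ, ⟨hq, hss, hns⟩, hG⟩ := ((hp.eventually_stack hinj (by simpa using by omega)
    (by simp) ⟨LinearMap.snd ℝ _ ℝ, fun i hi => liftedCurve_snd_eq_zero ((hmem i).1 hi),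
      fun i hi => liftedCurve_snd_pos hk (not_lt.1 ((hmem i).not.1 hi))⟩ hexp).and
      ((isSimplexFacet_liftedCurve hk hm).eventually_stack ⟨k, hm⟩ hout)).exists
  have hs := degSum_option (Finset.univ.image (Fin.castLE hm.le)) hss
    fun i => (hns i).trans (by simp only [mem_range, Finset.mem_image, Finset.mem_univ, true_and])
  rw [Finset.card_image_of_injective _ hinj, degSum_liftedCurve, Finset.card_univ,
    Fintype.card_fin] at hs
  exact ⟨(Fin 5 → ℝ) × ℝ, Option (Fin m), Fin 5, _, _, _, _, _, by simp, by simp, by simp,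
    hq, hs, _, _, hG⟩

end Neighborly
theorem hasFacet_of_bounds {n e : ℕ} (h1 : 5 * n + 5 < 2 * e) (h2 : 2 * e ≤ n * (n - 1)) :
    HasFacet 5 n (2 * e) := by
  rcases le_or_gt (e + 16) (5 * n) with h | h
  · exact hasFacet_of_le h1 h
  have hn : 7 ≤ n := by
    by_contra hn
    have : n ≤ 6 := by omega
    interval_cases n <;> omega
  rcases h2.eq_or_lt with h2 | h2
  · rw [h2]
    exact hasFacet_neighborly (by omega)
  obtain ⟨m, hm6, hmn, hm, hm'⟩ : ∃ m, 6 ≤ m ∧ m < n ∧ m * (m - 1) + 10 * n ≤ 2 * e + 10 * m ∧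
      2 * e + 10 * (m + 1) < (m + 1) * m + 10 * n := by
    by_contra! hcon
    have hind : ∀ j, 6 + j ≤ n →
        (6 + j) * (6 + j - 1) + 10 * n ≤ 2 * e + 10 * (6 + j) := by
      intro j
      induction j with
      | zero => omega
      | succ j ih =>
        intro hj
        exact hcon (6 + j) (by omega) (by omega) (ih (by omega))
    obtain ⟨j, rfl⟩ := Nat.exists_eq_add_of_le (by omega : 6 ≤ n)
    have := hind j le_rfl
    omega
  obtain ⟨c, hc⟩ := (Nat.even_mul_pred_self m)
  have hc' : (m + 1) * m = m * (m - 1) + 2 * m := by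
    obtain ⟨j, rfl⟩ := Nat.exists_eq_add_of_le (by omega : 1 ≤ m)
    simp
    ring
  have := (hasFacet_neighborly_stack (k := 5 + e + 5 * m - 5 * n - c) (m := m) (by omega)
    (by omega)).iterate_stack (n - (m + 1))
  convert this using 1 <;> omega

end ConeConfig

section Polytope

theorem IsExtreme.mem_convexHull_inter {E : Type*} [AddCommGroup E] [Module ℝ E] {P F T : Set E}
    (hP : Convex ℝ P) (hF : IsExtreme ℝ P F) (hT : T ⊆ P) {x : E} (hx : x ∈ F)
    (hxT : x ∈ convexHull ℝ T) : x ∈ convexHull ℝ (T ∩ F) := by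
  have hsub : convexHull ℝ (T \ F) ⊆ P \ F :=
    convexHull_min (sdiff_subset_sdiff_left hT) (hF.convex_sdiff hP)
  have hsub' : convexHull ℝ (T ∩ F) ⊆ P := convexHull_min (inter_subset_left.trans hT) hP
  rw [← inter_union_sdiff T F] at hxT
  rcases (T ∩ F).eq_empty_or_nonempty with h1 | h1
  · rw [h1, empty_union] at hxT
    exact absurd hx (hsub hxT).2
  rcases (T \ F).eq_empty_or_nonempty with h2 | h2
  · rwa [h2, union_empty] at hxT
  rw [convexHull_union h1 h2, mem_convexJoin] at hxT
  obtain ⟨a, ha, b, hb, hab⟩ := hxT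
  rw [← insert_endpoints_openSegment] at hab
  rcases hab with rfl | rfl | hab
  · exact ha
  · exact absurd hx (hsub hb).2
  · exact absurd (hF.right_mem_of_mem_openSegment (hsub' ha) (hsub hb).1 hx hab) (hsub hb).2

variable {n : ℕ} {P : Set (Fin n → ℝ)}

theorem IsPolytope.convex (hP : IsPolytope P) : Convex ℝ P := by
  obtain ⟨S, rfl⟩ := hP
  exact convex_convexHull ℝ _

theorem IsPolytope.finite_extremePoints (hP : IsPolytope P) : (extremePoints ℝ P).Finite := by
  obtain ⟨S, rfl⟩ := hP
  exact S.finite_toSet.subset extremePoints_convexHull_subset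

theorem IsPolytope.convexHull_extremePoints (hP : IsPolytope P) :
    convexHull ℝ (extremePoints ℝ P) = P := by
  have hc := hP.finite_extremePoints.isCompact_convexHull ℝ
  obtain ⟨S, hS⟩ := hP
  have hPc : IsCompact P := hS ▸ S.finite_toSet.isCompact_convexHull ℝ
  rw [← hc.isClosed.closure_eq]
  exact closure_convexHull_extremePoints hPc (hS ▸ convex_convexHull ℝ _)

theorem eq_or_eq_of_mem_segment {E : Type*} [AddCommGroup E] [Module ℝ E] {P : Set E} {a b c : E}
    (ha : a ∈ extremePoints ℝ P) (hb : b ∈ P) (hc : c ∈ P) (h : a ∈ segment ℝ b c) :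
    a = b ∨ a = c := by
  rw [← insert_endpoints_openSegment] at h
  rcases h with rfl | rfl | h
  · exact .inl rfl
  · exact .inr rfl
  · exact .inl (((mem_extremePoints.1 ha).2 b hb c hc h).1).symm

theorem vectorSpan_convexHull {n : ℕ} (S : Set (Fin n → ℝ)) :
    vectorSpan ℝ (convexHull ℝ S) = vectorSpan ℝ S := by
  rw [← direction_affineSpan, affineSpan_convexHull, direction_affineSpan]

theorem adim_convexHull_pair {u v : Fin n → ℝ} (h : u ≠ v) : adim (convexHull ℝ {u, v}) = 1 := by
  rw [adim, vectorSpan_convexHull, vectorSpan_pair]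
  exact finrank_span_singleton (sub_ne_zero.2 h)

theorem IsEdge.exists_eq_convexHull (hP : IsPolytope P) {F : Set (Fin n → ℝ)} (hF : IsEdge P F) :
    ∃ u ∈ extremePoints ℝ P, ∃ v ∈ extremePoints ℝ P, u ≠ v ∧ F = convexHull ℝ {u, v} := by
  obtain ⟨hE, hconv, hdim⟩ := hF
  have hFU : F = convexHull ℝ (extremePoints ℝ P ∩ F) := by
    refine Subset.antisymm (fun x hx => ?_) (convexHull_min inter_subset_right hconv)
    exact hE.mem_convexHull_inter hP.convex extremePoints_subset hx
      (hP.convexHull_extremePoints.symm ▸ hE.subset hx)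
  set U := extremePoints ℝ P ∩ F with hU
  have hdimU : Module.finrank ℝ (vectorSpan ℝ U) = 1 := by
    rw [← vectorSpan_convexHull, ← hFU]
    exact hdim
  have hcol : Collinear ℝ U := collinear_iff_finrank_le_one.2 hdimU.le
  have hnt : U.Nontrivial := by
    by_contra h
    rw [not_nontrivial_iff] at h
    rw [vectorSpan_of_subsingleton ℝ h, finrank_bot] at hdimU
    exact zero_ne_one hdimU
  obtain ⟨u, hu, v, hv, huv⟩ := hnt
  refine ⟨u, hu.1, v, hv.1, huv, ?_⟩
  rw [hFU]
  congr 1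
  refine Subset.antisymm (fun w hw => ?_) (pair_subset hu hv)
  have hsub : ({w, u, v} : Set (Fin n → ℝ)) ⊆ U := by
    rintro x (rfl | rfl | rfl) <;> assumption
  have key : ∀ {a b c}, a ∈ U → b ∈ U → c ∈ U → Wbtw ℝ a b c → b = a ∨ b = c :=
    fun ha hb hc h => eq_or_eq_of_mem_segment hb.1 ha.1.1 hc.1.1 (mem_segment_iff_wbtw.2 h)
  rcases (hcol.subset hsub).wbtw_or_wbtw_or_wbtw with h | h | h
  · rcases key hw hu hv h with h | h
    · exact .inl h.symm
    · exact absurd h huv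
  · rcases key hu hv hw h with h | h
    · exact absurd h.symm huv
    · exact .inr h.symm
  · exact key hv hw hu h |>.symm

theorem IsPolytope.two_mul_f₁_le (hP : IsPolytope P) : 2 * f₁ P ≤ f₀ P * (f₀ P - 1) := by
  classical
  set V := hP.finite_extremePoints.toFinset with hV
  have hf₀ : f₀ P = V.card := ncard_eq_toFinset_card _ hP.finite_extremePoints
  set pairs := V.offDiag.image (Function.uncurry Sym2.mk) with hpairs
  have hsub : {F | IsEdge P F} ⊆
      (fun z : Sym2 (Fin n → ℝ) => convexHull ℝ {x | x ∈ z}) '' (pairs : Set (Sym2 _)) := by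
    intro F hF
    obtain ⟨u, hu, v, hv, huv, rfl⟩ := IsEdge.exists_eq_convexHull hP hF
    refine ⟨s(u, v), ?_, ?_⟩
    · simp only [hpairs, Finset.coe_image]
      exact ⟨(u, v), by simp [hV, hu, hv, huv], rfl⟩
    · have hset : {x | x ∈ s(u, v)} = ({u, v} : Set (Fin n → ℝ)) := by
        ext x
        simp
      exact congrArg (convexHull ℝ) hset
  have h1 : f₁ P ≤ V.card.choose 2 := by
    rw [← Sym2.card_image_offDiag, ← ncard_coe_finset]
    exact (ncard_le_ncard hsub ((Finset.finite_toSet _).image _)).trans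
      (ncard_image_le (Finset.finite_toSet _))
  rw [hf₀]
  rw [Nat.choose_two_right] at h1
  omega

end Polytope

namespace ConeConfig

section Realize

theorem exposes_smul_comp_iff {E E' ι : Type*} [AddCommGroup E] [Module ℝ E] [AddCommGroup E']
    [Module ℝ E'] (e : E ≃ₗ[ℝ] E') {c : ι → ℝ} (hc : ∀ i, 0 < c i) (p : ι → E) (A : Set ι) :
    Exposes (fun i => c i • e (p i)) A ↔ Exposes p A := by
  constructor
  · rintro ⟨φ, h0, h1⟩
    refine ⟨φ ∘ₗ e.toLinearMap, fun i hi => ?_, fun i hi => ?_⟩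
    · have := h0 i hi
      simpa [(hc i).ne'] using this
    · have := h1 i hi
      simpa [hc i] using this
  · rintro ⟨φ, h0, h1⟩
    refine ⟨φ ∘ₗ e.symm.toLinearMap, fun i hi => ?_, fun i hi => ?_⟩
    · simp [h0 i hi]
    · simpa using mul_pos (hc i) (h1 i hi)

variable {ι : Type*} {n : ℕ} {y : ι → Fin n → ℝ}

theorem Exposes.isExtreme {A : Set ι} (h : Exposes y A) :
    IsExtreme ℝ (convexHull ℝ (range y)) (convexHull ℝ (y '' A)) := by
  obtain ⟨φ, h0, h1⟩ := h
  have hnn : ∀ x ∈ convexHull ℝ (range y), 0 ≤ φ x := by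
    refine fun x hx => convexHull_min (t := {x | 0 ≤ φ x}) ?_
      (convex_halfSpace_ge φ.isLinear 0) hx
    rintro _ ⟨i, rfl⟩
    by_cases hi : i ∈ A
    · exact (h0 i hi).ge
    · exact (h1 i hi).le
  have hface : IsExtreme ℝ (convexHull ℝ (range y)) {x ∈ convexHull ℝ (range y) | φ x = 0} := by
    refine ⟨fun x hx => hx.1, ?_⟩
    rintro a ha b hb x hx ⟨s, t, hs, ht, hst, rfl⟩
    refine ⟨ha, ?_⟩
    have h2 := hx.2
    simp only [map_add, map_smul, smul_eq_mul] at h2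
    have := hnn a ha
    have := mul_nonneg ht.le (hnn b hb)
    nlinarith
  convert hface
  refine Subset.antisymm (convexHull_min ?_ ?_) fun x hx => ?_
  · rintro _ ⟨i, hi, rfl⟩
    exact ⟨subset_convexHull ℝ _ (mem_range_self i), h0 i hi⟩
  · exact (convex_convexHull ℝ _).inter (convex_hyperplane φ.isLinear 0)
  · refine convexHull_mono ?_ (hface.mem_convexHull_inter (convex_convexHull ℝ _)
      (subset_convexHull ℝ _) hx hx.1)
    rintro _ ⟨⟨i, rfl⟩, hi⟩
    refine ⟨i, ?_, rfl⟩
    by_contra hiA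
    exact (h1 i hiA).ne' hi.2

theorem mem_of_mem_convexHull_image {A : Set ι} {i : ι} (h : Exposes y {i})
    (hi : y i ∈ convexHull ℝ (y '' A)) : i ∈ A := by
  obtain ⟨φ, h0, h1⟩ := h
  by_contra hiA
  have := convexHull_min (t := {x | 0 < φ x}) ?_ (convex_halfSpace_gt φ.isLinear 0) hi
  · exact (h0 i rfl).not_gt this
  · rintro _ ⟨j, hj, rfl⟩
    exact h1 j fun hji => hiA (hji ▸ hj)

theorem IsPointed.injective (hy : IsPointed y) : Function.Injective y := by
  intro i j hij
  have := mem_of_mem_convexHull_image (A := {j}) (hy.singleton i)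
    (subset_convexHull ℝ _ ⟨j, rfl, hij.symm⟩)
  exact this

theorem IsPointed.mem_convexHull_image_iff (hy : IsPointed y) {A : Set ι} {i : ι} :
    y i ∈ convexHull ℝ (y '' A) ↔ i ∈ A :=
  ⟨mem_of_mem_convexHull_image (hy.singleton i),
    fun h => subset_convexHull ℝ _ (mem_image_of_mem y h)⟩

theorem IsPointed.extremePoints_eq (hy : IsPointed y) :
    extremePoints ℝ (convexHull ℝ (range y)) = range y := by
  refine Subset.antisymm extremePoints_convexHull_subset ?_
  rintro _ ⟨i, rfl⟩
  have := (hy.singleton i).isExtreme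
  rwa [image_singleton, convexHull_singleton, isExtreme_singleton] at this

theorem isPolytope_convexHull_range [Finite ι] : IsPolytope (convexHull ℝ (range y)) :=
  ⟨(finite_range y).toFinset, by simp⟩

theorem IsPointed.f₀_eq [Fintype ι] (hy : IsPointed y) :
    f₀ (convexHull ℝ (range y)) = Fintype.card ι := by
  rw [f₀, hy.extremePoints_eq, ← image_univ, ncard_image_of_injective _ hy.injective, ncard_univ,
    Nat.card_eq_fintype_card]

theorem IsPointed.adim_add_one [Nonempty ι] (hy : IsPointed y) (g : (Fin n → ℝ) →ₗ[ℝ] ℝ)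
    (hg : ∀ i, g (y i) = 1) : adim (convexHull ℝ (range y)) + 1 = n := by
  rw [adim, vectorSpan_convexHull]
  obtain ⟨i₀⟩ := ‹Nonempty ι›
  have hle : vectorSpan ℝ (range y) ≤ LinearMap.ker g := by
    rw [vectorSpan_def, Submodule.span_le]
    rintro _ ⟨_, ⟨i, rfl⟩, _, ⟨j, rfl⟩, rfl⟩
    simp [hg]
  have hne : vectorSpan ℝ (range y) ≠ ⊤ := by
    intro h
    have : y i₀ ∈ LinearMap.ker g := hle (h ▸ Submodule.mem_top)
    rw [LinearMap.mem_ker, hg] at this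
    exact one_ne_zero this
  have h1 := Submodule.finrank_lt hne
  have htop : (⊤ : Submodule ℝ (Fin n → ℝ)) ≤ vectorSpan ℝ (range y) ⊔ Submodule.span ℝ {y i₀} := by
    rw [← hy.span, Submodule.span_le]
    rintro _ ⟨i, rfl⟩
    rw [← sub_add_cancel (y i) (y i₀)]
    exact Submodule.add_mem_sup
      (vsub_mem_vectorSpan ℝ (mem_range_self i) (mem_range_self i₀))
      (Submodule.mem_span_singleton_self _)
  have h2 := Submodule.finrank_mono htop
  have h3 := Submodule.finrank_add_le_finrank_add_finrank (vectorSpan ℝ (range y))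
    (Submodule.span ℝ {y i₀})
  have h4 : Module.finrank ℝ (Submodule.span ℝ {y i₀}) = 1 :=
    finrank_span_singleton fun h => by simpa [h] using hg i₀
  rw [finrank_top] at h2
  simp only [Module.finrank_fin_fun] at h1 h2
  omega

theorem IsPointed.exposes_pair_of_isExtreme [Finite ι] (hy : IsPointed y)
    (g : (Fin n → ℝ) →ₗ[ℝ] ℝ) (hg : ∀ i, g (y i) = 1) {i j : ι} (hij : i ≠ j)
    (h : IsExtreme ℝ (convexHull ℝ (range y)) (convexHull ℝ {y i, y j})) : Exposes y {i, j} := by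
  have hQsub : convexHull ℝ (y '' {i, j}ᶜ) ⊆
      convexHull ℝ (range y) \ convexHull ℝ {y i, y j} := by
    refine convexHull_min ?_ (h.convex_sdiff (convex_convexHull ℝ _))
    rintro _ ⟨k, hk, rfl⟩
    refine ⟨subset_convexHull ℝ _ (mem_range_self k), fun hk' => hk ?_⟩
    rwa [← image_pair, hy.mem_convexHull_image_iff] at hk'
  have hdisj : Disjoint (convexHull ℝ (y '' {i, j}ᶜ))
      (Submodule.span ℝ {y i, y j} : Set (Fin n → ℝ)) := by
    rw [Set.disjoint_left]
    intro x hxQ hxM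
    obtain ⟨hxP, hxF⟩ := hQsub hxQ
    refine hxF ?_
    obtain ⟨s, t, rfl⟩ := Submodule.mem_span_pair.1 hxM
    have hgx : g (s • y i + t • y j) = 1 := by
      refine convexHull_min (t := {x | g x = 1}) ?_ (convex_hyperplane g.isLinear 1) hxP
      rintro _ ⟨k, rfl⟩
      exact hg k
    have hst : s + t = 1 := by simpa [hg] using hgx
    have key : ∀ {k l : ι} {a b : ℝ}, k ≠ l →
        a • y k + b • y l ∈ convexHull ℝ (range y) → 0 ≤ b := by
      intro k l a b hkl hx
      obtain ⟨φ, h0, h1⟩ := hy.singleton k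
      have hφ : 0 ≤ φ (a • y k + b • y l) := by
        refine convexHull_min (t := {x | 0 ≤ φ x}) ?_ (convex_halfSpace_ge φ.isLinear 0) hx
        rintro _ ⟨m, rfl⟩
        by_cases hm : m = k
        · exact (h0 m hm).ge
        · exact (h1 m hm).le
      rw [map_add, map_smul, map_smul, h0 k rfl, smul_zero, zero_add, smul_eq_mul] at hφ
      exact nonneg_of_mul_nonneg_left hφ (h1 l hkl.symm)
    rw [convexHull_pair]
    exact ⟨s, t, key hij.symm (add_comm (s • y i) _ ▸ hxP), key hij hxP, hst, rfl⟩
  obtain ⟨f, u, v, hfu, huv, hfv⟩ := geometric_hahn_banach_compact_closed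
    (convex_convexHull ℝ _) ((toFinite (y '' {i, j}ᶜ)).isCompact_convexHull ℝ)
    (Submodule.convex _) (Submodule.closed_of_finiteDimensional _) hdisj
  have hzero : ∀ x ∈ Submodule.span ℝ {y i, y j}, f x = 0 := by
    intro x hx
    by_contra hne
    have := hfv _ (Submodule.smul_mem _ ((v - 1) / f x) hx)
    rw [map_smul, smul_eq_mul, div_mul_cancel₀ _ hne] at this
    linarith
  have hv : v < 0 := by simpa using hfv 0 (Submodule.zero_mem _)
  refine ⟨-f.toLinearMap, ?_, fun k hk => ?_⟩
  · rintro k (rfl | rfl)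
    · simpa using hzero _ (Submodule.subset_span (mem_insert _ _))
    · simpa using hzero _ (Submodule.subset_span (mem_insert_of_mem _ rfl))
  · have := hfu _ (subset_convexHull ℝ _ (mem_image_of_mem y hk))
    simp only [LinearMap.neg_apply, ContinuousLinearMap.coe_coe]
    linarith

theorem IsPointed.isEdge_iff [Finite ι] (hy : IsPointed y) (g : (Fin n → ℝ) →ₗ[ℝ] ℝ)
    (hg : ∀ i, g (y i) = 1) {F : Set (Fin n → ℝ)} :
    IsEdge (convexHull ℝ (range y)) F ↔ ∃ i j, Adj y i j ∧ convexHull ℝ {y i, y j} = F := by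
  constructor
  · intro hF
    obtain ⟨u, hu, v, hv, huv, rfl⟩ := hF.exists_eq_convexHull isPolytope_convexHull_range
    rw [hy.extremePoints_eq] at hu hv
    obtain ⟨i, rfl⟩ := hu
    obtain ⟨j, rfl⟩ := hv
    have hij : i ≠ j := fun h => huv (h ▸ rfl)
    exact ⟨i, j, ⟨hij, hy.exposes_pair_of_isExtreme g hg hij hF.1⟩, rfl⟩
  · rintro ⟨i, j, hij, rfl⟩
    refine ⟨?_, convex_convexHull ℝ _, adim_convexHull_pair (hy.injective.ne hij.1)⟩
    rw [← image_pair]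
    exact hij.2.isExtreme

theorem IsPointed.two_mul_f₁_eq [Fintype ι] (hy : IsPointed y) (g : (Fin n → ℝ) →ₗ[ℝ] ℝ)
    (hg : ∀ i, g (y i) = 1) : 2 * f₁ (convexHull ℝ (range y)) = degSum y := by
  classical
  let G : SimpleGraph ι := ⟨Adj y, ⟨fun _ _ => Adj.symm⟩, ⟨not_adj_self y⟩⟩
  have hset : {F | IsEdge (convexHull ℝ (range y)) F} =
      (fun z : Sym2 ι => convexHull ℝ (y '' {x | x ∈ z})) '' (G.edgeFinset : Set (Sym2 ι)) := by
    have hpair : ∀ i j, y '' {x | x ∈ s(i, j)} = {y i, y j} := fun i j => by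
      rw [← image_pair]
      congr 1
      ext x
      simp
    ext F
    rw [mem_ofPred_eq, hy.isEdge_iff g hg]
    constructor
    · rintro ⟨i, j, hij, rfl⟩
      refine ⟨s(i, j), by simpa using (hij : G.Adj i j), ?_⟩
      simp only [hpair]
    · rintro ⟨z, hz, rfl⟩
      induction z with
      | h i j =>
        refine ⟨i, j, by simpa using hz, ?_⟩
        simp only [hpair]
  have hinj : Function.Injective fun z : Sym2 ι => convexHull ℝ (y '' {x | x ∈ z}) := by
    intro z w hzw
    refine Sym2.ext fun i => ?_
    have := hy.mem_convexHull_image_iff (A := {x | x ∈ z}) (i := i)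
    simp only [hzw, hy.mem_convexHull_image_iff] at this
    exact this.symm
  rw [f₁, hset, ncard_image_of_injective _ hinj, ncard_coe_finset,
    ← G.sum_degrees_eq_twice_card_edges, degSum]
  refine Finset.sum_congr rfl fun i _ => ?_
  rw [← G.card_neighborFinset_eq_degree, G.neighborFinset_eq_filter, Finset.card_filter]

end Realize

theorem HasFacet.exists_polytope {d n s : ℕ} (hn : 0 < n) (h : HasFacet d n s) :
    ∃ P : Set (Fin (d + 1) → ℝ), IsDPolytope d P ∧ f₀ P = n ∧ 2 * f₁ P = s := by
  obtain ⟨E, ι, κ, _, _, _, _, p, hfin, hι, -, hp, rfl, -⟩ := h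
  have : FiniteDimensional ℝ E := FiniteDimensional.of_finrank_pos (by omega)
  have : Nonempty ι := Fintype.card_pos_iff.1 (by omega)
  let e : E ≃ₗ[ℝ] (Fin (d + 1) → ℝ) := LinearEquiv.ofFinrankEq _ _ (by simpa using hfin)
  obtain ⟨φ, -, hφ⟩ := hp.empty
  have hc : ∀ i, 0 < (φ (p i))⁻¹ := fun i => inv_pos.2 (hφ i (notMem_empty i))
  set y : ι → Fin (d + 1) → ℝ := fun i => (φ (p i))⁻¹ • e (p i) with hy_def
  have hexp : ∀ A, Exposes y A ↔ Exposes p A := exposes_smul_comp_iff e hc p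
  have hy : IsPointed y := by
    refine ⟨(hexp _).2 hp.empty, fun i => (hexp _).2 (hp.singleton i), ?_⟩
    rw [eq_top_iff, ← e.range, LinearMap.range_eq_map, ← hp.span,
      Submodule.map_span_le]
    rintro _ ⟨i, rfl⟩
    have := Submodule.smul_mem _ (φ (p i)) (Submodule.subset_span (mem_range_self (f := y) i))
    rwa [hy_def, smul_smul, mul_inv_cancel₀ (inv_pos.1 (hc i)).ne', one_smul] at this
  have hg : ∀ i, (φ ∘ₗ e.symm.toLinearMap) (y i) = 1 := fun i => by
    simp [hy_def, (inv_pos.1 (hc i)).ne']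
  refine ⟨convexHull ℝ (range y), ⟨isPolytope_convexHull_range, ?_⟩, hy.f₀_eq.trans hι, ?_⟩
  · exact Nat.succ_injective (hy.adim_add_one _ hg)
  · have hadj : ∀ i j, Adj y i j ↔ Adj p i j := fun i j => and_congr_right fun _ => hexp _
    classical
    rw [hy.two_mul_f₁_eq _ hg]
    exact Finset.sum_congr rfl fun i _ => Finset.sum_congr rfl fun j _ =>
      if_congr (hadj i j) rfl rfl

end ConeConfig

/-- The `(f₀, f₁)` pairs of 5-polytopes with excess degree `> 5` are exactly those
with `(5/2)·f₀ + 5/2 < f₁ ≤ f₀·(f₀-1)/2`. -/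
theorem stmt14 :
    {v : ℕ × ℕ | ∃ (n : ℕ) (P : Set (Fin n → ℝ)), IsDPolytope 5 P ∧
        f₀ P = v.1 ∧ f₁ P = v.2 ∧ 5 < 2 * (f₁ P : ℤ) - 5 * (f₀ P : ℤ)} =
      {v : ℕ × ℕ | 5 * v.1 + 5 < 2 * v.2 ∧ 2 * v.2 ≤ v.1 * (v.1 - 1)} := by
  ext ⟨n, e⟩
  simp only [mem_ofPred_eq]
  constructor
  · rintro ⟨m, P, hP, rfl, rfl, h⟩
    exact ⟨by omega, hP.1.two_mul_f₁_le⟩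
  · rintro ⟨h1, h2⟩
    have hn : 0 < n := by
      rcases n.eq_zero_or_pos with rfl | hn
      · omega
      · exact hn
    obtain ⟨P, hP, h0, he⟩ := (ConeConfig.hasFacet_of_bounds h1 h2).exists_polytope hn
    exact ⟨6, P, hP, h0, by omega, by omega⟩
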